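/- The function u^T is continuous on [0,T] × ℝ⁴ and is of class C² on [0,T) × ℝ⁴; that is, all partial derivatives of u^T in (t,x) up to order two exist and are continuous on [0,T) × ℝ⁴ (one-sided in t at t = 0). -/

import Mathlib

open MeasureTheory Finset

noncomputable section

/-- The 2π-periodic square wave ψ(r) = sign(sin r). -/
def psi (r : ℝ) : ℝ := Real.sign (Real.sin r)

/-- The vectors α_k ∈ ℝ⁴, α_{k,j} = 3/√2 if k = j and −1/√2 otherwise. -/
def alph : Fin 4 → Fin 4 → ℝ := fun k j => if k = j then 3 / Real.sqrt 2 else -(1 / Real.sqrt 2)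

/-- The vector θ = (1/√2)(1,1,−1,−1) ∈ ℝ⁴. -/
def theta : Fin 4 → ℝ :=
  ![1 / Real.sqrt 2, 1 / Real.sqrt 2, -(1 / Real.sqrt 2), -(1 / Real.sqrt 2)]

/-- Euclidean dot product on ℝ⁴. -/
def dot (a b : Fin 4 → ℝ) : ℝ := ∑ j, a j * b j

/-- The auxiliary function Λ(r,x). -/
def Lam (r : ℝ) (x : Fin 4 → ℝ) : ℝ :=
  psi (r * dot theta x + Real.pi / 2) * (∑ k, Real.cos (r * dot (alph k) x)) - 4
    - psi (r * dot theta x) * (∑ k, Real.sin (r * dot (alph k) x))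

/-- x^o : the increasing rearrangement of the coordinates of x. -/
def sortv (x : Fin 4 → ℝ) : Fin 4 → ℝ := fun i => x (Tuple.sort x i)

/-- The function u^T(t,x). -/
def u (T t : ℝ) (x : Fin 4 → ℝ) : ℝ :=
  -(1 / (16 * Real.sqrt 2)) *
      (∫ r : ℝ, Real.exp (-(T - t) * r ^ 2) * Lam r (sortv x) / r ^ 2)
    + (1 / 4) * ∑ i, x i + (1 / 2) * Real.sqrt ((T - t) * Real.pi / 2)

/-- Partial derivative in the i-th coordinate. -/
def pd (i : Fin 4) (f : (Fin 4 → ℝ) → ℝ) (x : Fin 4 → ℝ) : ℝ :=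
  deriv (fun s => f (Function.update x i s)) (x i)


section Mpart
set_option linter.unusedSectionVars false
variable {Ω : Type} [MeasurableSpace Ω]

/-- Rapid decay class. -/
def Hc (μ : Measure Ω) (A h : Ω → ℝ) : Prop :=
  ∀ a : ℝ, 0 < a → Integrable (fun ω => h ω * Real.exp (-(a * A ω ^ 2))) μ

def Mk (A B : Ω → ℝ) (φ : ℝ) (e : ℝ × ℝ) (ω : Ω) : ℝ :=
  Real.exp (-(e.1 * A ω ^ 2)) * Real.cos (e.2 * B ω + φ)

def M (μ : Measure Ω) (A B h : Ω → ℝ) (φ : ℝ) (e : ℝ × ℝ) : ℝ :=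
  ∫ ω, h ω * Mk A B φ e ω ∂μ

lemma sq_mul_exp_le (a y : ℝ) (ha : 0 < a) : y ^ 2 * Real.exp (-(a * y ^ 2)) ≤ 1 / a := by
  have h := Real.add_one_le_exp (a * y ^ 2)
  rw [Real.exp_neg, ← div_eq_mul_inv, div_le_div_iff₀ (Real.exp_pos _) ha]
  nlinarith

lemma Hc.mul_sq {μ : Measure Ω} {A h : Ω → ℝ} (hA : Measurable A) (hh : Hc μ A h) :
    Hc μ A (fun ω => h ω * A ω ^ 2) := by
  intro a ha
  have h1 := (hh (a / 2) (by positivity)).mul_bdd (g := fun ω => A ω ^ 2 * Real.exp (-(a / 2 * A ω ^ 2)))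
    (c := 1 / (a / 2)) (by fun_prop) (by
      refine Filter.Eventually.of_forall fun ω => ?_
      rw [Real.norm_of_nonneg (by positivity)]
      exact sq_mul_exp_le _ _ (by positivity))
  refine h1.congr (Filter.Eventually.of_forall fun ω => ?_)
  have : Real.exp (-(a * A ω ^ 2)) = Real.exp (-(a / 2 * A ω ^ 2)) * Real.exp (-(a / 2 * A ω ^ 2)) := by
    rw [← Real.exp_add]; ring_nf
  simp only [this]; ring

lemma Hc.mul_B {μ : Measure Ω} {A B h : Ω → ℝ} (hA : Measurable A) (hB : Measurable B)
    (hAB : ∀ᵐ ω ∂μ, |B ω| ≤ |A ω|) (hh : Hc μ A h) :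
    Hc μ A (fun ω => h ω * B ω) := by
  intro a ha
  have h1 := (hh (a / 2) (by positivity)).mul_bdd (g := fun ω => B ω * Real.exp (-(a / 2 * A ω ^ 2)))
    (c := 1 + 1 / (a / 2)) (by fun_prop) (by
      filter_upwards [hAB] with ω hω
      rw [norm_mul, Real.norm_of_nonneg (Real.exp_pos _).le, Real.norm_eq_abs]
      have h2 := sq_mul_exp_le (a / 2) (A ω) (by positivity)
      have h3 : Real.exp (-(a / 2 * A ω ^ 2)) ≤ 1 := by
        rw [Real.exp_le_one_iff]; have : 0 ≤ a / 2 * A ω ^ 2 := by positivity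
        linarith
      have h4 : |B ω| ≤ 1 + A ω ^ 2 := by
        have := hω
        have h5 := sq_abs (A ω)
        nlinarith [sq_nonneg (|A ω| - 1)]
      calc _ ≤ (1 + A ω ^ 2) * Real.exp (-(a / 2 * A ω ^ 2)) := by gcongr
        _ ≤ _ := by linarith)
  refine h1.congr (Filter.Eventually.of_forall fun ω => ?_)
  have : Real.exp (-(a * A ω ^ 2)) = Real.exp (-(a / 2 * A ω ^ 2)) * Real.exp (-(a / 2 * A ω ^ 2)) := by
    rw [← Real.exp_add]; ring_nf
  simp only [this]; ring

lemma Hc.meas {μ : Measure Ω} {A h : Ω → ℝ} (hA : Measurable A) (hh : Hc μ A h) :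
    AEStronglyMeasurable h μ := by
  have h1 := (hh 1 one_pos).aestronglyMeasurable
  have h2 : AEStronglyMeasurable (fun ω => Real.exp (1 * A ω ^ 2)) μ := by fun_prop
  refine (h1.mul h2).congr (Filter.Eventually.of_forall fun ω => ?_)
  simp only [Pi.mul_apply, mul_assoc, ← Real.exp_add]
  simp

lemma Mk_meas {A B : Ω → ℝ} (hA : Measurable A) (hB : Measurable B) (φ : ℝ) (e : ℝ × ℝ) :
    Measurable (Mk A B φ e) := by
  unfold Mk; fun_prop

lemma Mk_le (A B : Ω → ℝ) (φ : ℝ) (e : ℝ × ℝ) (ω : Ω) :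
    |Mk A B φ e ω| ≤ Real.exp (-(e.1 * A ω ^ 2)) := by
  unfold Mk
  rw [abs_mul, abs_of_pos (Real.exp_pos _)]
  exact mul_le_of_le_one_right (Real.exp_pos _).le (Real.abs_cos_le_one _)

lemma M_integrable {μ : Measure Ω} {A B h : Ω → ℝ} (hA : Measurable A) (hB : Measurable B)
    (hh : Hc μ A h) (φ : ℝ) (e : ℝ × ℝ) (he : 0 < e.1) :
    Integrable (fun ω => h ω * Mk A B φ e ω) μ := by
  refine (hh e.1 he).mono ((hh.meas hA).mul (Mk_meas hA hB φ e).aestronglyMeasurable) ?_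
  refine Filter.Eventually.of_forall fun ω => ?_
  rw [norm_mul, norm_mul, Real.norm_of_nonneg (Real.exp_pos _).le]
  gcongr
  exact Mk_le A B φ e ω

lemma Mk_hasFDerivAt (A B : Ω → ℝ) (φ : ℝ) (e : ℝ × ℝ) (ω : Ω) :
    HasFDerivAt (fun e => Mk A B φ e ω)
      ((-(A ω ^ 2 * Mk A B φ e ω)) • ContinuousLinearMap.fst ℝ ℝ ℝ
        + (B ω * Mk A B (φ + Real.pi / 2) e ω) • ContinuousLinearMap.snd ℝ ℝ ℝ) e := by
  have h1 : HasFDerivAt (fun e : ℝ × ℝ => e.1) (ContinuousLinearMap.fst ℝ ℝ ℝ) e := hasFDerivAt_fst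
  have h2 : HasFDerivAt (fun e : ℝ × ℝ => e.2) (ContinuousLinearMap.snd ℝ ℝ ℝ) e := hasFDerivAt_snd
  have h3 := ((h1.mul_const (A ω ^ 2)).neg).exp
  have h4 := ((h2.mul_const (B ω)).add_const φ).cos
  refine (h3.mul h4).congr_fderiv ?_
  unfold Mk
  rw [← add_assoc, Real.cos_add_pi_div_two]
  ext <;> simp <;> ring

lemma M_hasFDerivAt {μ : Measure Ω} {A B h : Ω → ℝ} (hA : Measurable A) (hB : Measurable B)
    (hAB : ∀ᵐ ω ∂μ, |B ω| ≤ |A ω|) (hh : Hc μ A h) (φ : ℝ) (e : ℝ × ℝ) (he : 0 < e.1) :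
    HasFDerivAt (M μ A B h φ)
      ((-(M μ A B (fun ω => h ω * A ω ^ 2) φ e)) • ContinuousLinearMap.fst ℝ ℝ ℝ
        + (M μ A B (fun ω => h ω * B ω) (φ + Real.pi / 2) e) • ContinuousLinearMap.snd ℝ ℝ ℝ) e := by
  have hA2 := hh.mul_sq hA
  have hB1 := hh.mul_B hA hB hAB
  have i1 := M_integrable hA hB hA2 φ e he
  have i2 := M_integrable hA hB hB1 (φ + Real.pi / 2) e he
  have j1 : Integrable (fun ω => (-(h ω * A ω ^ 2 * Mk A B φ e ω)) • ContinuousLinearMap.fst ℝ ℝ ℝ) μ :=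
    i1.neg.smul_const _
  have j2 : Integrable (fun ω => (h ω * B ω * Mk A B (φ + Real.pi / 2) e ω) •
    ContinuousLinearMap.snd ℝ ℝ ℝ) μ := i2.smul_const _
  have key := hasFDerivAt_integral_of_dominated_of_fderiv_le (μ := μ) (𝕜 := ℝ)
    (F := fun e ω => h ω * Mk A B φ e ω) (x₀ := e) (s := {e' | e.1 / 2 < e'.1})
    (F' := fun e ω => (-(h ω * A ω ^ 2 * Mk A B φ e ω)) • ContinuousLinearMap.fst ℝ ℝ ℝ
        + (h ω * B ω * Mk A B (φ + Real.pi / 2) e ω) • ContinuousLinearMap.snd ℝ ℝ ℝ)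
    (bound := fun ω => |h ω * A ω ^ 2 * Real.exp (-(e.1 / 2 * A ω ^ 2))|
      + |h ω * B ω * Real.exp (-(e.1 / 2 * A ω ^ 2))|)
    ?_ ?_ ?_ ?_ ?_ ?_ ?_
  · refine key.congr_fderiv ?_
    rw [integral_add j1 j2, integral_smul_const, integral_smul_const,
      integral_neg]
    rfl
  · exact (isOpen_lt continuous_const continuous_fst).mem_nhds (by simp; linarith)
  · exact Filter.Eventually.of_forall fun e' =>
      (hh.meas hA).mul (Mk_meas hA hB φ e').aestronglyMeasurable
  · exact M_integrable hA hB hh φ e he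
  · exact j1.aestronglyMeasurable.add j2.aestronglyMeasurable
  · refine Filter.Eventually.of_forall fun ω e' he' => ?_
    have hle : ∀ φ, |Mk A B φ e' ω| ≤ Real.exp (-(e.1 / 2 * A ω ^ 2)) := fun φ =>
      (Mk_le A B φ e' ω).trans (by
        apply Real.exp_le_exp.2
        have : e.1 / 2 < e'.1 := he'
        nlinarith [sq_nonneg (A ω)])
    refine (norm_add_le _ _).trans (add_le_add ?_ ?_)
    · rw [norm_smul, norm_neg, norm_mul, abs_mul, abs_of_pos (Real.exp_pos _)]
      calc _ ≤ ‖h ω * A ω ^ 2‖ * Real.exp (-(e.1 / 2 * A ω ^ 2)) * 1 := by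
            gcongr
            · exact hle φ
            · exact ContinuousLinearMap.norm_fst_le ℝ ℝ ℝ
        _ = _ := by rw [mul_one]; rfl
    · rw [norm_smul, norm_mul, abs_mul (h ω * B ω), abs_of_pos (Real.exp_pos _)]
      calc _ ≤ ‖h ω * B ω‖ * Real.exp (-(e.1 / 2 * A ω ^ 2)) * 1 := by
            gcongr
            · exact hle _
            · exact ContinuousLinearMap.norm_snd_le ℝ ℝ ℝ
        _ = _ := by rw [mul_one]; rfl
  · exact (hA2 _ (by positivity)).abs.add (hB1 _ (by positivity)).abs
  · refine Filter.Eventually.of_forall fun ω e' he' => ?_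
    refine ((Mk_hasFDerivAt A B φ e' ω).const_mul (h ω)).congr_fderiv ?_
    ext <;> simp <;> ring

lemma M_contDiffOn {μ : Measure Ω} {A B : Ω → ℝ} (hA : Measurable A) (hB : Measurable B)
    (hAB : ∀ᵐ ω ∂μ, |B ω| ≤ |A ω|) (n : ℕ) : ∀ (h : Ω → ℝ) (_ : Hc μ A h) (φ : ℝ),
    ContDiffOn ℝ n (M μ A B h φ) {e | 0 < e.1} := by
  have hop : IsOpen {e : ℝ × ℝ | 0 < e.1} := isOpen_lt continuous_const continuous_fst
  induction n with
  | zero =>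
    intro h hh φ
    simp only [Nat.cast_zero, contDiffOn_zero]
    exact fun e he => (M_hasFDerivAt hA hB hAB hh φ e he).continuousAt.continuousWithinAt
  | succ n ih =>
    intro h hh φ
    push_cast
    rw [contDiffOn_succ_iff_fderiv_of_isOpen hop]
    refine ⟨fun e he => (M_hasFDerivAt hA hB hAB hh φ e he).differentiableAt.differentiableWithinAt,
      fun h => by simp at h, ?_⟩
    refine ContDiffOn.congr (f := fun e => (-(M μ A B (fun ω => h ω * A ω ^ 2) φ e)) • ContinuousLinearMap.fst ℝ ℝ ℝ
        + (M μ A B (fun ω => h ω * B ω) (φ + Real.pi / 2) e) • ContinuousLinearMap.snd ℝ ℝ ℝ) ?_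
      fun e he => (M_hasFDerivAt hA hB hAB hh φ e he).fderiv
    exact ((ih _ (hh.mul_sq hA) φ).neg.smul contDiffOn_const).add
      ((ih _ (hh.mul_B hA hB hAB) _).smul contDiffOn_const)

end Mpart

section Wpart
set_option linter.unusedSectionVars false
variable {Ω : Type} [MeasurableSpace Ω]

def W (μ : Measure Ω) (A B h : Ω → ℝ) (j : ℕ) (φ : ℝ) (e : ℝ × ℝ × ℝ) : ℝ :=
  if 0 < e.2.1 then (e.2.1)⁻¹ ^ j * M μ A B h φ (e.1 * (e.2.1)⁻¹ ^ 2, e.2.2 * (e.2.1)⁻¹) else 0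

abbrev pS : ℝ × ℝ × ℝ →L[ℝ] ℝ := ContinuousLinearMap.fst ℝ ℝ (ℝ × ℝ)
abbrev pP : ℝ × ℝ × ℝ →L[ℝ] ℝ := (ContinuousLinearMap.fst ℝ ℝ ℝ).comp (ContinuousLinearMap.snd ℝ ℝ (ℝ × ℝ))
abbrev pY : ℝ × ℝ × ℝ →L[ℝ] ℝ := (ContinuousLinearMap.snd ℝ ℝ ℝ).comp (ContinuousLinearMap.snd ℝ ℝ (ℝ × ℝ))

def W' (μ : Measure Ω) (A B h : Ω → ℝ) (j : ℕ) (φ : ℝ) (e : ℝ × ℝ × ℝ) : ℝ × ℝ × ℝ →L[ℝ] ℝ :=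
  (-(W μ A B (fun ω => h ω * A ω ^ 2) (j + 2) φ e)) • pS
  + (W μ A B (fun ω => h ω * B ω) (j + 1) (φ + Real.pi / 2) e) • pY
  + (-(j * W μ A B h (j + 1) φ e) + 2 * e.1 * W μ A B (fun ω => h ω * A ω ^ 2) (j + 3) φ e
      - e.2.2 * W μ A B (fun ω => h ω * B ω) (j + 2) (φ + Real.pi / 2) e) • pP

lemma W_hasFDerivAt_pos {μ : Measure Ω} {A B h : Ω → ℝ} (hA : Measurable A) (hB : Measurable B)
    (hAB : ∀ᵐ ω ∂μ, |B ω| ≤ |A ω|) (hh : Hc μ A h) (j : ℕ) (φ : ℝ) (e : ℝ × ℝ × ℝ) (he : 0 < e.1)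
    (hp : 0 < e.2.1) :
    HasFDerivAt (W μ A B h j φ) (W' μ A B h j φ e) e := by
  have hop : {e : ℝ × ℝ × ℝ | 0 < e.2.1} ∈ nhds e :=
    (isOpen_lt continuous_const (continuous_fst.comp continuous_snd)).mem_nhds hp
  have hS : HasFDerivAt (fun e : ℝ × ℝ × ℝ => e.1) pS e := pS.hasFDerivAt
  have hP : HasFDerivAt (fun e : ℝ × ℝ × ℝ => e.2.1) pP e := pP.hasFDerivAt
  have hY : HasFDerivAt (fun e : ℝ × ℝ × ℝ => e.2.2) pY e := pY.hasFDerivAt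
  have hv : HasFDerivAt (fun e : ℝ × ℝ × ℝ => (e.2.1)⁻¹) ((-(e.2.1 ^ 2)⁻¹) • pP) e :=
    (hasDerivAt_inv hp.ne').comp_hasFDerivAt e hP
  have hM := (M_hasFDerivAt (μ := μ) hA hB hAB hh φ (e.1 * (e.2.1)⁻¹ ^ 2, e.2.2 * (e.2.1)⁻¹)
    (by positivity)).comp e ((hS.mul (hv.pow 2)).prodMk (hY.mul hv))
  have h1 := (hv.pow j).mul hM
  refine (h1.congr_of_eventuallyEq ?_).congr_fderiv ?_
  · filter_upwards [hop] with e' he'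
    have : 0 < e'.2.1 := he'
    simp [W, this]
  · unfold W' W
    simp only [hp, if_true]
    generalize M μ A B (fun ω => h ω * A ω ^ 2) φ _ = M1
    generalize M μ A B (fun ω => h ω * B ω) _ _ = M2
    have e0 : (e.2.1 ^ 2)⁻¹ = (e.2.1)⁻¹ ^ 2 := by rw [inv_pow]
    rw [e0]
    simp only [Function.comp_def]
    generalize M μ A B h _ _ = M0
    generalize (e.2.1)⁻¹ = v
    rcases j with _ | j
    · ext <;> simp <;> ring
    · ext <;> simp <;> ring

lemma flat_aux (κ p : ℝ) (hκ : 0 < κ) (hp : 0 < p) (hp1 : p ≤ 1) (j : ℕ) :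
    p⁻¹ ^ j * Real.exp (-(κ * p⁻¹ ^ 2)) ≤ ((j + 2).factorial / κ ^ (j + 2)) * p ^ 2 := by
  have h := Real.pow_div_factorial_le_exp (κ * p⁻¹ ^ 2) (by positivity) (j + 2)
  have hf : (0 : ℝ) < (j + 2).factorial := by exact_mod_cast Nat.factorial_pos _
  have h2 : Real.exp (-(κ * p⁻¹ ^ 2)) ≤ (j + 2).factorial / (κ * p⁻¹ ^ 2) ^ (j + 2) := by
    rw [Real.exp_neg, inv_le_comm₀ (Real.exp_pos _) (by positivity), inv_div]
    exact h
  have h3 : p ^ (j + 4) ≤ p ^ 2 := pow_le_pow_of_le_one hp.le hp1 (by omega)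
  calc _ ≤ p⁻¹ ^ j * ((j + 2).factorial / (κ * p⁻¹ ^ 2) ^ (j + 2)) := by gcongr
    _ = ((j + 2).factorial / κ ^ (j + 2)) * p ^ (j + 4) := by
      have e1 : (κ * p⁻¹ ^ 2) ^ (j + 2) = κ ^ (j + 2) * (p ^ (2 * (j + 2)))⁻¹ := by
        rw [mul_pow, ← pow_mul, inv_pow]
      have e2 : p ^ (2 * (j + 2)) = p ^ (j + 4) * p ^ j := by rw [← pow_add]; congr 1; ring
      rw [e1, e2, inv_pow]
      field_simp
    _ ≤ _ := by gcongr

lemma W_bound {μ : Measure Ω} {A B h : Ω → ℝ} (hA : Measurable A)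
    (hA1 : ∀ᵐ ω ∂μ, 1 ≤ A ω ^ 2) (hh : Hc μ A h) (j : ℕ) (φ : ℝ) (s₀ : ℝ) (hs : 0 < s₀) :
    ∃ C, ∀ e : ℝ × ℝ × ℝ, s₀ ≤ e.1 → e.2.1 ≤ 1 → |W μ A B h j φ e| ≤ C * e.2.1 ^ 2 := by
  refine ⟨((j + 2).factorial / (s₀ / 2) ^ (j + 2)) * ∫ ω, |h ω * Real.exp (-(s₀ / 2 * A ω ^ 2))| ∂μ,
    fun e he hp1 => ?_⟩
  have hI : 0 ≤ ∫ ω, |h ω * Real.exp (-(s₀ / 2 * A ω ^ 2))| ∂μ := integral_nonneg fun _ => abs_nonneg _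
  have hf : (0 : ℝ) < (j + 2).factorial := by exact_mod_cast Nat.factorial_pos _
  unfold W
  split_ifs with hp
  swap
  · rw [abs_zero]; positivity
  have h1 : |M μ A B h φ (e.1 * (e.2.1)⁻¹ ^ 2, e.2.2 * (e.2.1)⁻¹)| ≤
      ∫ ω, Real.exp (-(s₀ / 2 * (e.2.1)⁻¹ ^ 2)) * |h ω * Real.exp (-(s₀ / 2 * A ω ^ 2))| ∂μ := by
    rw [← Real.norm_eq_abs]
    unfold M
    refine norm_integral_le_of_norm_le ((hh _ (by positivity)).abs.const_mul _) ?_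
    filter_upwards [hA1] with ω hω
    rw [norm_mul, abs_mul, abs_of_pos (Real.exp_pos _), Real.norm_eq_abs, Real.norm_eq_abs]
    have h2 := Mk_le A B φ (e.1 * (e.2.1)⁻¹ ^ 2, e.2.2 * (e.2.1)⁻¹) ω
    have h3 : Real.exp (-(e.1 * (e.2.1)⁻¹ ^ 2 * A ω ^ 2)) ≤
        Real.exp (-(s₀ / 2 * (e.2.1)⁻¹ ^ 2)) * Real.exp (-(s₀ / 2 * A ω ^ 2)) := by
      rw [← Real.exp_add, Real.exp_le_exp]
      have h4 : 1 ≤ (e.2.1)⁻¹ ^ 2 := one_le_pow₀ ((one_le_inv₀ hp).2 hp1)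
      have h5 : (e.2.1)⁻¹ ^ 2 ≤ (e.2.1)⁻¹ ^ 2 * A ω ^ 2 := le_mul_of_one_le_right (by positivity) hω
      have h6 : A ω ^ 2 ≤ (e.2.1)⁻¹ ^ 2 * A ω ^ 2 := le_mul_of_one_le_left (by positivity) h4
      have h7 : s₀ * ((e.2.1)⁻¹ ^ 2 * A ω ^ 2) ≤ e.1 * ((e.2.1)⁻¹ ^ 2 * A ω ^ 2) := by gcongr
      nlinarith
    calc _ ≤ |h ω| * (Real.exp (-(s₀ / 2 * (e.2.1)⁻¹ ^ 2)) * Real.exp (-(s₀ / 2 * A ω ^ 2))) := by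
          gcongr; exact h2.trans h3
      _ = _ := by ring
  rw [integral_const_mul] at h1
  rw [abs_mul, abs_of_nonneg (by positivity)]
  calc _ ≤ (e.2.1)⁻¹ ^ j * (Real.exp (-(s₀ / 2 * (e.2.1)⁻¹ ^ 2)) * ∫ ω, |h ω * Real.exp (-(s₀ / 2 * A ω ^ 2))| ∂μ) := by
        gcongr
    _ = ((e.2.1)⁻¹ ^ j * Real.exp (-(s₀ / 2 * (e.2.1)⁻¹ ^ 2))) * ∫ ω, |h ω * Real.exp (-(s₀ / 2 * A ω ^ 2))| ∂μ := by ring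
    _ ≤ (((j + 2).factorial / (s₀ / 2) ^ (j + 2)) * e.2.1 ^ 2) * ∫ ω, |h ω * Real.exp (-(s₀ / 2 * A ω ^ 2))| ∂μ := by
        exact mul_le_mul_of_nonneg_right (flat_aux _ _ (by positivity) hp hp1 j) hI
    _ = _ := by ring

lemma W'_nonpos {μ : Measure Ω} {A B h : Ω → ℝ} (j : ℕ) (φ : ℝ) (e : ℝ × ℝ × ℝ) (hp : e.2.1 ≤ 0) :
    W' μ A B h j φ e = 0 := by
  unfold W' W
  simp [not_lt.2 hp]

lemma W_hasFDerivAt {μ : Measure Ω} {A B h : Ω → ℝ} (hA : Measurable A) (hB : Measurable B)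
    (hAB : ∀ᵐ ω ∂μ, |B ω| ≤ |A ω|) (hA1 : ∀ᵐ ω ∂μ, 1 ≤ A ω ^ 2)
    (hh : Hc μ A h) (j : ℕ) (φ : ℝ) (e : ℝ × ℝ × ℝ) (he : 0 < e.1) :
    HasFDerivAt (W μ A B h j φ) (W' μ A B h j φ e) e := by
  rcases lt_or_ge 0 e.2.1 with hp | hp
  · exact W_hasFDerivAt_pos hA hB hAB hh j φ e he hp
  rw [W'_nonpos j φ e hp]
  rcases hp.lt_or_eq with hp | hp
  · have hop : {e : ℝ × ℝ × ℝ | e.2.1 < 0} ∈ nhds e :=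
      (isOpen_lt (continuous_fst.comp continuous_snd) continuous_const).mem_nhds hp
    refine (hasFDerivAt_const (0 : ℝ) e).congr_of_eventuallyEq ?_
    filter_upwards [hop] with e' he'
    have : e'.2.1 < 0 := he'
    simp [W, this.le]
  · obtain ⟨C, hC⟩ := W_bound (B := B) hA hA1 hh j φ (e.1 / 2) (by positivity)
    have h0 : W μ A B h j φ e = 0 := by simp [W, hp]
    refine HasFDerivAt.of_isLittleO ?_
    have hO : (fun e' => W μ A B h j φ e' - W μ A B h j φ e - (0 : ℝ × ℝ × ℝ →L[ℝ] ℝ) (e' - e)) =O[nhds e]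
        fun e' => ‖e' - e‖ ^ 2 := by
      refine Asymptotics.IsBigO.of_bound |C| ?_
      have n1 : {e' : ℝ × ℝ × ℝ | e.1 / 2 < e'.1} ∈ nhds e :=
        (isOpen_lt continuous_const continuous_fst).mem_nhds (by simp; linarith)
      have n2 : {e' : ℝ × ℝ × ℝ | e'.2.1 < 1} ∈ nhds e :=
        (isOpen_lt (continuous_fst.comp continuous_snd) continuous_const).mem_nhds (by simp [hp])
      filter_upwards [n1, n2] with e' h1 h2
      have h3 := hC e' (le_of_lt h1) (le_of_lt h2)
      have h4 : |e'.2.1| ≤ ‖e' - e‖ := by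
        have : e'.2.1 = (e' - e).2.1 := by simp [hp]
        rw [this]
        exact (norm_fst_le (e' - e).2).trans (norm_snd_le (e' - e))
      rw [h0]
      simp only [sub_zero, zero_apply, norm_pow, Real.norm_eq_abs, abs_norm]
      calc _ ≤ C * e'.2.1 ^ 2 := h3
        _ ≤ |C| * |e'.2.1| ^ 2 := by rw [sq_abs]; gcongr; exact le_abs_self C
        _ ≤ _ := mul_le_mul_of_nonneg_left (pow_le_pow_left₀ (abs_nonneg _) h4 2) (abs_nonneg C)
    refine hO.trans_isLittleO ?_
    exact Asymptotics.isLittleO_norm_right.1 (by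
      simpa using Asymptotics.isLittleO_pow_sub_sub e (m := 2) (by norm_num))

lemma W_contDiffOn {μ : Measure Ω} {A B : Ω → ℝ} (hA : Measurable A) (hB : Measurable B)
    (hAB : ∀ᵐ ω ∂μ, |B ω| ≤ |A ω|) (hA1 : ∀ᵐ ω ∂μ, 1 ≤ A ω ^ 2) (n : ℕ) :
    ∀ (h : Ω → ℝ) (_ : Hc μ A h) (j : ℕ) (φ : ℝ),
    ContDiffOn ℝ n (W μ A B h j φ) {e | 0 < e.1} := by
  have hop : IsOpen {e : ℝ × ℝ × ℝ | 0 < e.1} := isOpen_lt continuous_const continuous_fst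
  induction n with
  | zero =>
    intro h hh j φ
    simp only [Nat.cast_zero, contDiffOn_zero]
    exact fun e he => (W_hasFDerivAt hA hB hAB hA1 hh j φ e he).continuousAt.continuousWithinAt
  | succ n ih =>
    intro h hh j φ
    push_cast
    rw [contDiffOn_succ_iff_fderiv_of_isOpen hop]
    refine ⟨fun e he => (W_hasFDerivAt hA hB hAB hA1 hh j φ e he).differentiableAt.differentiableWithinAt,
      fun h => by simp at h, ?_⟩
    refine ContDiffOn.congr (f := fun e => W' μ A B h j φ e) ?_
      fun e he => (W_hasFDerivAt hA hB hAB hA1 hh j φ e he).fderiv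
    unfold W'
    have a2 := hh.mul_sq hA
    have b1 := hh.mul_B hA hB hAB
    have cS : ContDiffOn ℝ n (fun e : ℝ × ℝ × ℝ => e.1) {e | 0 < e.1} := contDiff_fst.contDiffOn
    have cY : ContDiffOn ℝ n (fun e : ℝ × ℝ × ℝ => e.2.2) {e | 0 < e.1} :=
      (contDiff_snd.comp contDiff_snd).contDiffOn
    have cc : ContDiffOn ℝ n (fun e : ℝ × ℝ × ℝ => (-(j * W μ A B h (j + 1) φ e) + 2 * e.1 * W μ A B (fun ω => h ω * A ω ^ 2) (j + 3) φ e
      - e.2.2 * W μ A B (fun ω => h ω * B ω) (j + 2) (φ + Real.pi / 2) e)) {e | 0 < e.1} := ((contDiffOn_const.mul (ih _ hh _ φ)).neg.add ((contDiffOn_const.mul cS).mul (ih _ a2 _ φ))).sub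
      (cY.mul (ih _ b1 _ _))
    exact (((ih _ a2 _ φ).neg.smul contDiffOn_const).add ((ih _ b1 _ _).smul contDiffOn_const)).add
      (cc.smul contDiffOn_const)

end Wpart

section Glue
variable {E F ι : Type} [NormedAddCommGroup E] [NormedSpace ℝ E] [NormedAddCommGroup F] [NormedSpace ℝ F]
  [Finite ι]

lemma glue_cont {X Y : Type} [TopologicalSpace X] [TopologicalSpace Y] {C : ι → Set X}
    (hC : ∀ i, IsClosed (C i)) (hcov : ∀ x, ∃ i, x ∈ C i)
    {f : X → Y} {x : X} (h : ∀ i, x ∈ C i → ContinuousWithinAt f (C i) x) : ContinuousAt f x := by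
  rw [← continuousWithinAt_univ, show (Set.univ : Set X) = ⋃ i, C i by
    ext y; simpa using hcov y, ContinuousWithinAt, nhdsWithin_iUnion, Filter.tendsto_iSup]
  intro i
  by_cases hx : x ∈ C i
  · exact h i hx
  · have : nhdsWithin x (C i) = ⊥ := by
      rw [← notMem_closure_iff_nhdsWithin_eq_bot, (hC i).closure_eq]; exact hx
    rw [this]; exact Filter.tendsto_bot

lemma glue_fderiv {C : ι → Set E}
    (hC : ∀ i, IsClosed (C i)) (hcov : ∀ x, ∃ i, x ∈ C i)
    {f : E → F} {f' : E →L[ℝ] F} {x : E} (h : ∀ i, x ∈ C i → HasFDerivWithinAt f f' (C i) x) :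
    HasFDerivAt f f' x := by
  rw [hasFDerivAt_iff_isLittleO, ← nhdsWithin_univ, show (Set.univ : Set E) = ⋃ i, C i by
    ext y; simpa using hcov y, nhdsWithin_iUnion, Asymptotics.isLittleO_iff]
  intro c hc
  rw [Filter.eventually_iSup]
  intro i
  by_cases hx : x ∈ C i
  · exact (Asymptotics.isLittleO_iff.1 (h i hx).isLittleO) hc
  · have : nhdsWithin x (C i) = ⊥ := by
      rw [← notMem_closure_iff_nhdsWithin_eq_bot, (hC i).closure_eq]; exact hx
    rw [this]; exact Filter.eventually_bot

def emb (L : E →L[ℝ] ℝ) : E →L[ℝ] ℝ × E := L.prod (ContinuousLinearMap.id ℝ E)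

def gx (g : ℝ × E → ℝ) (w : ℝ × E) : E →L[ℝ] ℝ := (fderiv ℝ g w).comp (ContinuousLinearMap.inr ℝ ℝ E)

lemma glue_main {C : ι → Set E} (hC : ∀ i, IsClosed (C i)) (hcov : ∀ x, ∃ i, x ∈ C i)
    (U : Set E) (hU : IsOpen U) (L : ι → E →L[ℝ] ℝ) (g : ℝ × E → ℝ)
    (hg : ContDiffOn ℝ 2 g {w | w.2 ∈ U}) (f : E → ℝ)
    (hf : ∀ i, ∀ x ∈ C i, f x = g (emb (L i) x))
    (hB : ∀ i, ∀ x ∈ U, fderiv ℝ g (emb (L i) x) (1, 0) = 0)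
    (htie : ∀ i j x, x ∈ C i → x ∈ C j → L i x = L j x) :
    ContDiffOn ℝ 2 f U := by
  have hV : IsOpen {w : ℝ × E | w.2 ∈ U} := hU.preimage continuous_snd
  have hg' : DifferentiableOn ℝ g {w | w.2 ∈ U} ∧ ContDiffOn ℝ 1 (fderiv ℝ g) {w | w.2 ∈ U} := by
    rw [show (2 : WithTop ℕ∞) = 1 + 1 by norm_num, contDiffOn_succ_iff_fderiv_of_isOpen hV] at hg
    exact ⟨hg.1, hg.2.2⟩
  obtain ⟨hd1, hc1⟩ := hg'
  have hc1' : DifferentiableOn ℝ (fderiv ℝ g) {w | w.2 ∈ U} ∧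
      ContinuousOn (fderiv ℝ (fderiv ℝ g)) {w | w.2 ∈ U} := by
    rw [show (1 : WithTop ℕ∞) = 0 + 1 by norm_num, contDiffOn_succ_iff_fderiv_of_isOpen hV,
      contDiffOn_zero] at hc1
    exact ⟨hc1.1, hc1.2.2⟩
  obtain ⟨hd2, hc2⟩ := hc1'
  have hgx : ContDiffOn ℝ 1 (gx g) {w | w.2 ∈ U} := hc1.clm_comp contDiffOn_const
  have hgx' : DifferentiableOn ℝ (gx g) {w | w.2 ∈ U} ∧
      ContinuousOn (fderiv ℝ (gx g)) {w | w.2 ∈ U} := by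
    rw [show (1 : WithTop ℕ∞) = 0 + 1 by norm_num, contDiffOn_succ_iff_fderiv_of_isOpen hV,
      contDiffOn_zero] at hgx
    exact ⟨hgx.1, hgx.2.2⟩
  obtain ⟨hgd, hgc⟩ := hgx'
  have mem : ∀ i, ∀ x ∈ U, emb (L i) x ∈ {w : ℝ × E | w.2 ∈ U} := fun i x hx => hx
  -- first derivative
  have s1 : ∀ i, ∀ x ∈ U, HasFDerivAt (fun x => g (emb (L i) x)) (gx g (emb (L i) x)) x := by
    intro i x hx
    have h1 := ((hd1.differentiableAt (hV.mem_nhds (mem i x hx))).hasFDerivAt).comp x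
      (emb (L i)).hasFDerivAt
    refine h1.congr_fderiv ?_
    ext v
    have e1 : emb (L i) v = (L i v) • ((1 : ℝ), (0 : E)) + (0, v) := by
      simp [emb]
    simp only [ContinuousLinearMap.comp_apply, gx, ContinuousLinearMap.inr_apply]
    rw [e1, map_add, map_smul, hB i x hx]; simp
  have s2 : ∀ i, ∀ x ∈ U, HasFDerivAt (fun x => gx g (emb (L i) x))
      ((fderiv ℝ (gx g) (emb (L i) x)).comp (emb (L i))) x := fun i x hx =>
    ((hgd.differentiableAt (hV.mem_nhds (mem i x hx))).hasFDerivAt).comp x (emb (L i)).hasFDerivAt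
  -- derivative of gx
  have gxd : ∀ w : ℝ × E, w.2 ∈ U → ∀ v v', fderiv ℝ (gx g) w v v' = fderiv ℝ (fderiv ℝ g) w v (0, v') := by
    intro w hw v v'
    have h1 := (hd2.differentiableAt (hV.mem_nhds hw)).hasFDerivAt.clm_comp
      (hasFDerivAt_const (ContinuousLinearMap.inr ℝ ℝ E) w)
    have h2 : fderiv ℝ (gx g) w = _ := h1.fderiv
    rw [h2]; simp
  have embtie : ∀ i j x, x ∈ C i → x ∈ C j → emb (L i) x = emb (L j) x := by
    intro i j x hi hj
    simp [emb, htie i j x hi hj]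
  have tie2 : ∀ i j, ∀ x ∈ U, x ∈ C i → x ∈ C j →
      (fderiv ℝ (gx g) (emb (L i) x)).comp (emb (L i)) = (fderiv ℝ (gx g) (emb (L j) x)).comp (emb (L j)) := by
    intro i j x hx hi hj
    have hQ : ∀ k, x ∈ C k → ∀ v', fderiv ℝ (fderiv ℝ g) (emb (L i) x) (emb (L k) v') (1, 0) = 0 := by
      intro k hk v'
      have h1 : HasFDerivAt (fun x => fderiv ℝ g (emb (L k) x) (1, 0)) _ x :=
        (((hd2.differentiableAt (hV.mem_nhds (mem k x hx))).hasFDerivAt).comp x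
          (emb (L k)).hasFDerivAt).clm_apply (hasFDerivAt_const ((1 : ℝ), (0 : E)) x)
      have h2 : HasFDerivAt (fun x => fderiv ℝ g (emb (L k) x) (1, 0)) (0 : E →L[ℝ] ℝ) x := by
        refine (hasFDerivAt_const (0 : ℝ) x).congr_of_eventuallyEq ?_
        filter_upwards [hU.mem_nhds hx] with y hy using hB k y hy
      have h3 := congrArg (fun T => T v') (h1.unique h2)
      rw [embtie i k x hi hk]
      simpa using h3
    have e1 : ∀ k v, emb (L k) v = (L k v) • ((1 : ℝ), (0 : E)) + (0, v) := by
      intro k v; simp [emb]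
    rw [← embtie i j x hi hj]
    ext v v'
    simp only [ContinuousLinearMap.comp_apply]
    by_cases hv : L i v = L j v
    · rw [e1 i v, e1 j v, hv]
    have q1 := hQ i hi v
    have q2 := hQ j hj v
    rw [e1 i v, map_add, map_smul] at q1
    rw [e1 j v, map_add, map_smul] at q2
    simp only [add_apply, smul_apply, smul_eq_mul] at q1 q2
    have q3 : fderiv ℝ (fderiv ℝ g) (emb (L i) x) (1, 0) (1, 0) = 0 := by
      have : (L i v - L j v) * fderiv ℝ (fderiv ℝ g) (emb (L i) x) (1, 0) (1, 0) = 0 := by linarith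
      rcases mul_eq_zero.1 this with h | h
      · exact absurd (sub_eq_zero.1 h) hv
      · exact h
    have q4 : fderiv ℝ (fderiv ℝ g) (emb (L i) x) (0, v') (1, 0) = 0 := by
      have := hQ i hi v'
      rw [e1 i v', map_add, map_smul] at this
      simp only [add_apply, smul_apply, smul_eq_mul] at this
      rw [q3] at this; linarith
    have hsym := (hg.contDiffAt (hV.mem_nhds (mem i x hx))).isSymmSndFDerivAt (by simp)
    have q5 : fderiv ℝ (fderiv ℝ g) (emb (L i) x) (1, 0) (0, v') = 0 := by
      rw [hsym.eq]; exact q4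
    rw [gxd _ (mem i x hx), gxd _ (mem i x hx), e1 i v, e1 j v, map_add, map_add, map_smul, map_smul]
    simp [q5]
  choose idx hidx using hcov
  have hcov : ∀ x, ∃ i, x ∈ C i := fun x => ⟨idx x, hidx x⟩
  let D1 : E → E →L[ℝ] ℝ := fun x => gx g (emb (L (idx x)) x)
  let D2 : E → E →L[ℝ] E →L[ℝ] ℝ := fun x =>
    (fderiv ℝ (gx g) (emb (L (idx x)) x)).comp (emb (L (idx x)))
  have hD1 : ∀ i, ∀ x ∈ C i, D1 x = gx g (emb (L i) x) := fun i x hx => by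
    simp only [D1]; rw [embtie _ _ x (hidx x) hx]
  have hD2 : ∀ i, ∀ x ∈ U, x ∈ C i → D2 x = (fderiv ℝ (gx g) (emb (L i) x)).comp (emb (L i)) :=
    fun i x hxU hx => tie2 _ _ x hxU (hidx x) hx
  have d1 : ∀ x ∈ U, HasFDerivAt f (D1 x) x := fun x hx =>
    glue_fderiv hC hcov fun i hi => by
      rw [hD1 i x hi]
      exact (s1 i x hx).hasFDerivWithinAt.congr (fun y hy => hf i y hy) (hf i x hi)
  have d2 : ∀ x ∈ U, HasFDerivAt D1 (D2 x) x := fun x hx =>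
    glue_fderiv hC hcov fun i hi => by
      rw [hD2 i x hx hi]
      exact (s2 i x hx).hasFDerivWithinAt.congr (fun y hy => hD1 i y hy) (hD1 i x hi)
  have c2 : ContinuousOn D2 U := by
    intro x hx
    refine ContinuousAt.continuousWithinAt (glue_cont hC hcov fun i hi => ?_)
    have h1 : ContinuousAt (fun x => (fderiv ℝ (gx g) (emb (L i) x)).comp (emb (L i))) x := by
      have : ContinuousAt (fun x => fderiv ℝ (gx g) (emb (L i) x)) x :=
        ContinuousAt.comp (f := fun x => emb (L i) x) (hgc.continuousAt (hV.mem_nhds (mem i x hx)))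
          (emb (L i)).continuous.continuousAt
      exact this.clm_comp continuousAt_const
    refine h1.continuousWithinAt.congr_of_eventuallyEq ?_ (hD2 i x hx hi)
    filter_upwards [self_mem_nhdsWithin, mem_nhdsWithin_of_mem_nhds (hU.mem_nhds hx)] with y hy hyU
    exact hD2 i y hyU hy
  rw [show (2 : WithTop ℕ∞) = 1 + 1 by norm_num, contDiffOn_succ_iff_fderiv_of_isOpen hU]
  refine ⟨fun x hx => (d1 x hx).differentiableAt.differentiableWithinAt, fun h => by simp at h, ?_⟩
  refine ContDiffOn.congr (f := D1) ?_ fun x hx => (d1 x hx).fderiv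
  rw [show (1 : WithTop ℕ∞) = 0 + 1 by norm_num, contDiffOn_succ_iff_fderiv_of_isOpen hU, contDiffOn_zero]
  refine ⟨fun x hx => (d2 x hx).differentiableAt.differentiableWithinAt, fun h => by simp at h, ?_⟩
  exact c2.congr fun x hx => (d2 x hx).fderiv

end Glue

lemma psi_meas : Measurable psi := by
  unfold psi
  have h : Measurable Real.sign := by
    unfold Real.sign
    exact Measurable.ite measurableSet_Iio measurable_const
      (Measurable.ite measurableSet_Ioi measurable_const measurable_const)
  exact h.comp Real.measurable_sin

lemma abs_sign_le (a : ℝ) : |Real.sign a| ≤ 1 := by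
  rcases lt_trichotomy a 0 with h | h | h
  · simp [Real.sign_of_neg h]
  · simp [h]
  · simp [Real.sign_of_pos h]

lemma abs_psi_le (a : ℝ) : |psi a| ≤ 1 := abs_sign_le _

lemma sign_mul_self' (a : ℝ) : Real.sign a * a = |a| := by
  rcases lt_trichotomy a 0 with h | h | h
  · rw [Real.sign_of_neg h, abs_of_neg h]; ring
  · simp [h]
  · rw [Real.sign_of_pos h, abs_of_pos h]; ring

lemma psi_shift (a : ℝ) : psi (a + Real.pi / 2) = Real.sign (Real.cos a) := by
  unfold psi; rw [Real.sin_add_pi_div_two]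

lemma sign_diff (a b : ℝ) : |Real.sign a - Real.sign b| * |b| ≤ 2 * |a - b| := by
  rcases lt_trichotomy a 0 with h | h | h <;> rcases lt_trichotomy b 0 with h' | h' | h'
  · simp [Real.sign_of_neg h, Real.sign_of_neg h']
  · simp [h']
  · rw [Real.sign_of_neg h, Real.sign_of_pos h', abs_of_pos h', abs_of_neg (by linarith : a - b < 0)]
    norm_num; linarith
  · rw [Real.sign_of_neg h', h]; simp; linarith [abs_nonneg b]
  · simp [h']
  · rw [Real.sign_of_pos h', h]; simp; linarith [abs_nonneg b]
  · rw [Real.sign_of_pos h, Real.sign_of_neg h', abs_of_neg h', abs_of_pos (by linarith : 0 < a - b)]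
    norm_num; linarith
  · simp [h']
  · simp [Real.sign_of_pos h, Real.sign_of_pos h']

lemma psi_one (q : ℝ) (h0 : 0 < q) (h1 : q ≤ 1) : psi (q + Real.pi / 2) = 1 ∧ psi q = 1 := by
  have := Real.pi_gt_three
  constructor
  · rw [psi_shift]
    exact Real.sign_of_pos (Real.cos_pos_of_mem_Ioo ⟨by linarith, by linarith⟩)
  · unfold psi
    exact Real.sign_of_pos (Real.sin_pos_of_pos_of_lt_pi h0 (by linarith))

def th2 : Fin 4 → ℝ :=
  ![1 / Real.sqrt 2, -(1 / Real.sqrt 2), 1 / Real.sqrt 2, -(1 / Real.sqrt 2)]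
def th3 : Fin 4 → ℝ :=
  ![1 / Real.sqrt 2, -(1 / Real.sqrt 2), -(1 / Real.sqrt 2), 1 / Real.sqrt 2]

lemma alph_expand (x : Fin 4 → ℝ) :
    dot (alph 0) x = dot theta x + dot th2 x + dot th3 x ∧
    dot (alph 1) x = dot theta x - dot th2 x - dot th3 x ∧
    dot (alph 2) x = -dot theta x + dot th2 x - dot th3 x ∧
    dot (alph 3) x = -dot theta x - dot th2 x + dot th3 x := by
  simp only [dot, Fin.sum_univ_four, alph, theta, th2, th3]
  simp
  refine ⟨?_, ?_, ?_, ?_⟩ <;> ring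

lemma sum_alph (x : Fin 4 → ℝ) : ∑ k, dot (alph k) x = 0 := by
  obtain ⟨h0, h1, h2, h3⟩ := alph_expand x
  rw [Fin.sum_univ_four, h0, h1, h2, h3]; ring

lemma sum_cos (r : ℝ) (x : Fin 4 → ℝ) : ∑ k, Real.cos (r * dot (alph k) x) =
    4 * Real.cos (r * dot theta x) * Real.cos (r * dot th2 x) * Real.cos (r * dot th3 x) := by
  obtain ⟨h0, h1, h2, h3⟩ := alph_expand x
  rw [Fin.sum_univ_four, h0, h1, h2, h3]
  simp only [mul_add, mul_sub, mul_neg, Real.cos_add, Real.cos_sub, Real.sin_add, Real.sin_sub, Real.cos_neg,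
    Real.sin_neg]
  ring

lemma sum_sin (r : ℝ) (x : Fin 4 → ℝ) : ∑ k, Real.sin (r * dot (alph k) x) =
    -(4 * Real.sin (r * dot theta x) * Real.sin (r * dot th2 x) * Real.sin (r * dot th3 x)) := by
  obtain ⟨h0, h1, h2, h3⟩ := alph_expand x
  rw [Fin.sum_univ_four, h0, h1, h2, h3]
  simp only [mul_add, mul_sub, mul_neg, Real.cos_add, Real.cos_sub, Real.sin_add, Real.sin_sub, Real.cos_neg,
    Real.sin_neg]
  ring

lemma Lam_eq (r : ℝ) (x : Fin 4 → ℝ) : Lam r x =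
    4 * |Real.cos (r * dot theta x)| * Real.cos (r * dot th2 x) * Real.cos (r * dot th3 x) - 4
      + 4 * |Real.sin (r * dot theta x)| * Real.sin (r * dot th2 x) * Real.sin (r * dot th3 x) := by
  unfold Lam
  rw [sum_cos, sum_sin, psi_shift, ← sign_mul_self' (Real.cos _), ← sign_mul_self' (Real.sin (r * dot theta x))]
  unfold psi
  ring

lemma Lam_abs (r : ℝ) (x : Fin 4 → ℝ) : Lam |r| x = Lam r x := by
  rcases abs_choice r with h | h
  · rw [h]
  · rw [h, Lam_eq, Lam_eq]
    simp only [neg_mul, Real.cos_neg, Real.sin_neg, abs_neg]; ring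

lemma dot_continuous (a : Fin 4 → ℝ) : Continuous (dot a) := by unfold dot; fun_prop

lemma Lam_continuous : Continuous (fun w : ℝ × (Fin 4 → ℝ) => Lam w.1 w.2) := by
  simp only [Lam_eq]
  have h1 := dot_continuous theta
  have h2 := dot_continuous th2
  have h3 := dot_continuous th3
  fun_prop

lemma abs_sin_le' (a : ℝ) : |Real.sin a| ≤ |a| := Real.abs_sin_le_abs

lemma Lam_bound (r : ℝ) (x : Fin 4 → ℝ) :
    |Lam r x| ≤ (12 + 2 * (dot theta x ^ 2 + dot th2 x ^ 2 + dot th3 x ^ 2) + 4 * (|dot th2 x| * |dot th3 x|)) *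
      (r ^ 2 * (1 + r ^ 2)⁻¹ * (1 + 1)) := by
  set a := dot theta x
  set b := dot th2 x
  set c := dot th3 x
  have h1 : |Lam r x| ≤ 12 := by
    rw [Lam_eq]
    have e1 : |4 * |Real.cos (r * a)| * Real.cos (r * b) * Real.cos (r * c)| ≤ 4 := by
      rw [abs_mul, abs_mul, abs_mul, abs_abs]
      have := Real.abs_cos_le_one (r * a)
      have := Real.abs_cos_le_one (r * b)
      have := Real.abs_cos_le_one (r * c)
      calc _ ≤ |(4 : ℝ)| * 1 * 1 * 1 := by gcongr
        _ = 4 := by norm_num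
    have e2 : |4 * |Real.sin (r * a)| * Real.sin (r * b) * Real.sin (r * c)| ≤ 4 := by
      rw [abs_mul, abs_mul, abs_mul, abs_abs]
      have := Real.abs_sin_le_one (r * a)
      have := Real.abs_sin_le_one (r * b)
      have := Real.abs_sin_le_one (r * c)
      calc _ ≤ |(4 : ℝ)| * 1 * 1 * 1 := by gcongr
        _ = 4 := by norm_num
    rw [abs_le] at *
    constructor <;> linarith [e1.1, e1.2, e2.1, e2.2]
  have h2 : |Lam r x| ≤ (2 * (a ^ 2 + b ^ 2 + c ^ 2) + 4 * (|b| * |c|)) * r ^ 2 := by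
    rw [Lam_eq]
    have e2 : |4 * |Real.sin (r * a)| * Real.sin (r * b) * Real.sin (r * c)| ≤ 4 * (|b| * |c|) * r ^ 2 := by
      rw [abs_mul, abs_mul, abs_mul, abs_abs]
      have := Real.abs_sin_le_one (r * a)
      have := abs_sin_le' (r * b)
      have := abs_sin_le' (r * c)
      calc _ ≤ |(4 : ℝ)| * 1 * |r * b| * |r * c| := by gcongr
        _ = 4 * (|b| * |c|) * |r| ^ 2 := by rw [abs_mul, abs_mul, abs_of_pos (by norm_num : (0 : ℝ) < 4)]; ring
        _ = _ := by rw [sq_abs]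
    have e1 : |4 * |Real.cos (r * a)| * Real.cos (r * b) * Real.cos (r * c) - 4| ≤ 2 * (a ^ 2 + b ^ 2 + c ^ 2) * r ^ 2 := by
      have a1 := Real.abs_cos_le_one (r * a)
      have a2 := Real.one_sub_sq_div_two_le_cos (x := r * a)
      have a3 := le_abs_self (Real.cos (r * a))
      have a4 := abs_nonneg (Real.cos (r * a))
      have b2 := Real.one_sub_sq_div_two_le_cos (x := r * b)
      have c2 := Real.one_sub_sq_div_two_le_cos (x := r * c)
      have b3 := Real.cos_le_one (r * b)
      have c3 := Real.cos_le_one (r * c)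
      have b4 := Real.neg_one_le_cos (r * b)
      have c4 := Real.neg_one_le_cos (r * c)
      set A := |Real.cos (r * a)|
      set B := Real.cos (r * b)
      set D := Real.cos (r * c)
      have hBD : B * D ≤ 1 := by nlinarith
      have hAB : A * B ≤ 1 := by nlinarith
      have hAB' : -1 ≤ A * B := by nlinarith
      have p1 : A * B * D ≤ 1 := by nlinarith
      have p2 : 1 - A * B * D ≤ (1 - A) + (1 - B) + (1 - D) := by
        have : 1 - A * B * D = (1 - A) + A * (1 - B) + A * B * (1 - D) := by ring
        nlinarith
      rw [abs_le]; constructor <;> nlinarith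
    calc _ ≤ _ := abs_add_le _ _
      _ ≤ 2 * (a ^ 2 + b ^ 2 + c ^ 2) * r ^ 2 + 4 * (|b| * |c|) * r ^ 2 := add_le_add e1 e2
      _ = _ := by ring
  have hq : 0 ≤ 2 * (a ^ 2 + b ^ 2 + c ^ 2) + 4 * (|b| * |c|) := by positivity
  set K := 2 * (a ^ 2 + b ^ 2 + c ^ 2) + 4 * (|b| * |c|) with hK
  have : (12 + 2 * (a ^ 2 + b ^ 2 + c ^ 2) + 4 * (|b| * |c|)) = 12 + K := by rw [hK]; ring
  rw [this]
  have e : (12 + K) * (r ^ 2 * (1 + r ^ 2)⁻¹ * (1 + 1)) = ((12 + K) * r ^ 2 * 2) / (1 + r ^ 2) := by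
    field_simp; norm_num
  rw [e, le_div_iff₀ (by positivity)]
  rcases le_total (r ^ 2) 1 with hr | hr
  · nlinarith [abs_nonneg (Lam r x), sq_nonneg r, mul_nonneg hq (sq_nonneg r)]
  · nlinarith [abs_nonneg (Lam r x), sq_nonneg r, mul_nonneg hq (sq_nonneg r)]

/-- permutation invariance -/
lemma dot_alph_perm (σ : Equiv.Perm (Fin 4)) (k : Fin 4) (x : Fin 4 → ℝ) :
    dot (alph k) (x ∘ σ) = dot (alph (σ k)) x := by
  unfold dot
  rw [← Equiv.sum_comp σ (fun j => alph (σ k) j * x j)]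
  refine Finset.sum_congr rfl fun j _ => ?_
  simp [alph]

lemma sum_alph_perm (σ : Equiv.Perm (Fin 4)) (G : ℝ → ℝ) (x : Fin 4 → ℝ) :
    ∑ k, G (dot (alph k) (x ∘ σ)) = ∑ k, G (dot (alph k) x) := by
  simp only [dot_alph_perm]
  exact Equiv.sum_comp σ (fun k => G (dot (alph k) x))

lemma theta_neg {z : Fin 4 → ℝ} (hz : Monotone z) : dot theta z ≤ 0 ∧
    (dot theta z = 0 → ∀ k, dot (alph k) z = 0) := by
  have h1 : z 0 ≤ z 1 := hz (by decide)
  have h2 : z 1 ≤ z 2 := hz (by decide)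
  have h3 : z 2 ≤ z 3 := hz (by decide)
  have hs : 0 < (Real.sqrt 2)⁻¹ := by positivity
  have e : dot theta z = (Real.sqrt 2)⁻¹ * (z 0 + z 1 - z 2 - z 3) := by
    simp only [dot, Fin.sum_univ_four, theta]; simp; ring
  constructor
  · rw [e]; nlinarith
  · intro h k
    rw [e] at h
    have h4 : z 0 + z 1 - z 2 - z 3 = 0 := by
      rcases mul_eq_zero.1 h with h | h
      · exact absurd h hs.ne'
      · exact h
    have a1 : z 1 = z 0 := by linarith
    have a2 : z 2 = z 0 := by linarith
    have a3 : z 3 = z 0 := by linarith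
    simp only [dot, Fin.sum_univ_four, a1, a2, a3]
    fin_cases k <;> simp [alph] <;> ring

lemma sortv_of_monotone (x : Fin 4 → ℝ) (σ : Equiv.Perm (Fin 4)) (h : Monotone (x ∘ σ)) :
    sortv x = x ∘ σ := (Tuple.comp_sort_eq_comp_iff_monotone.2 h).symm

lemma closed_mono (σ : Equiv.Perm (Fin 4)) : IsClosed {x : Fin 4 → ℝ | Monotone (x ∘ σ)} := by
  have : {x : Fin 4 → ℝ | Monotone (x ∘ σ)} = ⋂ (i) (j) (_ : i ≤ j), {x | x (σ i) ≤ x (σ j)} := by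
    ext x; simp [Monotone]
  rw [this]
  refine isClosed_iInter fun i => isClosed_iInter fun j => isClosed_iInter fun _ => ?_
  exact isClosed_le (continuous_apply _) (continuous_apply _)

lemma sortv_continuous : Continuous sortv := by
  rw [continuous_iff_continuousAt]
  intro x
  refine glue_cont closed_mono (fun x => ⟨Tuple.sort x, Tuple.monotone_sort x⟩) fun σ hσ => ?_
  have : Continuous (fun x : Fin 4 → ℝ => x ∘ σ) := by fun_prop
  exact this.continuousWithinAt.congr (fun y hy => sortv_of_monotone y σ hy) (sortv_of_monotone x σ hσ)

def G (s : ℝ) (x : Fin 4 → ℝ) : ℝ := ∫ r : ℝ, Real.exp (-s * r ^ 2) * Lam r (sortv x) / r ^ 2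

lemma G_continuousOn : ContinuousOn (fun e : ℝ × (Fin 4 → ℝ) => G e.1 e.2) {e | 0 ≤ e.1} := by
  intro e he
  let Kf : (Fin 4 → ℝ) → ℝ := fun x => 12 + 2 * (dot theta (sortv x) ^ 2 + dot th2 (sortv x) ^ 2 + dot th3 (sortv x) ^ 2)
    + 4 * (|dot th2 (sortv x)| * |dot th3 (sortv x)|)
  have hKc : Continuous Kf := by
    have h1 := (dot_continuous theta).comp sortv_continuous
    have h2 := (dot_continuous th2).comp sortv_continuous
    have h3 := (dot_continuous th3).comp sortv_continuous
    simp only [Function.comp_def] at h1 h2 h3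
    simp only [Kf]
    fun_prop
  have hLm : ∀ x, Measurable (fun r => Lam r x) := fun x =>
    (Lam_continuous.comp (continuous_id.prodMk continuous_const)).measurable
  refine continuousWithinAt_of_dominated (F := fun (e : ℝ × (Fin 4 → ℝ)) r => Real.exp (-e.1 * r ^ 2) * Lam r (sortv e.2) / r ^ 2)
    (bound := fun r => (Kf e.2 + 1) * 2 * (1 + r ^ 2)⁻¹) ?_ ?_ ?_ ?_
  · refine Filter.Eventually.of_forall fun e => Measurable.aestronglyMeasurable ?_
    have := hLm (sortv e.2)
    fun_prop
  · have hn : {e' : ℝ × (Fin 4 → ℝ) | Kf e'.2 < Kf e.2 + 1} ∈ nhds e :=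
      (isOpen_lt (hKc.comp continuous_snd) continuous_const).mem_nhds (by simp)
    filter_upwards [self_mem_nhdsWithin, mem_nhdsWithin_of_mem_nhds hn] with e' h0 h1
    refine Filter.Eventually.of_forall fun r => ?_
    have h0' : 0 ≤ e'.1 := h0
    have h1' : Kf e'.2 < Kf e.2 + 1 := h1
    have hb := Lam_bound r (sortv e'.2)
    have hexp : Real.exp (-e'.1 * r ^ 2) ≤ 1 := by
      rw [Real.exp_le_one_iff]; nlinarith [mul_nonneg h0' (sq_nonneg r)]
    have hKp : 0 ≤ Kf e'.2 := by simp only [Kf]; positivity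
    rw [norm_div, norm_mul, Real.norm_of_nonneg (Real.exp_pos _).le, Real.norm_of_nonneg (sq_nonneg r),
      Real.norm_eq_abs]
    rcases eq_or_ne r 0 with hr | hr
    · subst hr; simp; linarith
    rw [div_le_iff₀ (by positivity)]
    calc _ ≤ 1 * |Lam r (sortv e'.2)| := by gcongr
      _ ≤ Kf e'.2 * (r ^ 2 * (1 + r ^ 2)⁻¹ * (1 + 1)) := by rw [one_mul]; exact hb
      _ ≤ (Kf e.2 + 1) * (r ^ 2 * (1 + r ^ 2)⁻¹ * (1 + 1)) := by gcongr
      _ = _ := by ring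
  · exact integrable_inv_one_add_sq.const_mul _
  · refine Filter.Eventually.of_forall fun r => Continuous.continuousWithinAt ?_
    have h : Continuous (fun e : ℝ × (Fin 4 → ℝ) => Lam r (sortv e.2)) :=
      Continuous.comp (g := fun w : ℝ × (Fin 4 → ℝ) => Lam w.1 w.2)
        (f := fun e : ℝ × (Fin 4 → ℝ) => (r, sortv e.2)) Lam_continuous
        (continuous_const.prodMk (sortv_continuous.comp continuous_snd))
    have h' : Continuous (fun e : ℝ × (Fin 4 → ℝ) => Real.exp (-e.1 * r ^ 2)) := by fun_prop
    exact (h'.mul h).div_const _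

/-! The smooth symmetric part -/

def nuF : Measure (ℝ × ℝ) := (volume.restrict (Set.Ioi 0)).prod (volume.restrict (Set.Ioc 0 1))

def FI (s y r : ℝ) : ℝ :=
  Real.exp (-s * r ^ 2) * (Real.cos (r * y) - 1 + (Real.sin (r * y) - r * y)) / r ^ 2

def FF (e : ℝ × ℝ) : ℝ := ∫ r in Set.Ioi (0 : ℝ), FI e.1 e.2 r

lemma taylor_cos (z : ℝ) : ∫ t in (0 : ℝ)..1, z ^ 2 * ((1 - t) * Real.cos (t * z)) = 1 - Real.cos z := by
  have h := intervalIntegral.integral_eq_sub_of_hasDerivAt (a := 0) (b := 1)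
    (f := fun t => z * (1 - t) * Real.sin (t * z) - Real.cos (t * z))
    (f' := fun t => z ^ 2 * ((1 - t) * Real.cos (t * z))) (fun t _ => ?_)
    (Continuous.intervalIntegrable (by fun_prop) _ _)
  · rw [h]; simp; ring
  · have h1 : HasDerivAt (fun t : ℝ => t * z) (1 * z) t := (hasDerivAt_id t).mul_const z
    have h2 : HasDerivAt (fun t : ℝ => z * (1 - t)) (z * (-1)) t := ((hasDerivAt_id t).const_sub 1).const_mul z
    refine ((h2.mul h1.sin).sub h1.cos).congr_deriv ?_
    ring

lemma taylor_sin (z : ℝ) : ∫ t in (0 : ℝ)..1, z ^ 2 * ((1 - t) * Real.sin (t * z)) = z - Real.sin z := by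
  have h := intervalIntegral.integral_eq_sub_of_hasDerivAt (a := 0) (b := 1)
    (f := fun t => -(z * (1 - t)) * Real.cos (t * z) - Real.sin (t * z))
    (f' := fun t => z ^ 2 * ((1 - t) * Real.sin (t * z))) (fun t _ => ?_)
    (Continuous.intervalIntegrable (by fun_prop) _ _)
  · rw [h]; simp; ring
  · have h1 : HasDerivAt (fun t : ℝ => t * z) (1 * z) t := (hasDerivAt_id t).mul_const z
    have h2 : HasDerivAt (fun t : ℝ => z * (1 - t)) (z * (-1)) t := ((hasDerivAt_id t).const_sub 1).const_mul z
    have h3 : HasDerivAt (fun t : ℝ => -(z * (1 - t))) (-(z * (-1))) t := h2.neg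
    refine ((h3.mul h1.cos).sub h1.sin).congr_deriv ?_
    ring

def tA (ω : ℝ × ℝ) : ℝ := ω.1
def tB (ω : ℝ × ℝ) : ℝ := ω.1 * ω.2
def tH (ω : ℝ × ℝ) : ℝ := 1 - ω.2

lemma nuF_ae : ∀ᵐ ω ∂nuF, ω.2 ∈ Set.Ioc (0 : ℝ) 1 := by
  unfold nuF
  exact Measure.quasiMeasurePreserving_snd.ae (ae_restrict_mem measurableSet_Ioc)

lemma tHc : Hc nuF tA tH := by
  intro a ha
  unfold nuF tA tH
  have h1 : Integrable (fun r : ℝ => Real.exp (-(a * r ^ 2))) (volume.restrict (Set.Ioi 0)) := by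
    have := (integrable_exp_neg_mul_sq ha).restrict (s := Set.Ioi (0 : ℝ))
    simpa only [neg_mul] using this
  have h2 : Integrable (fun t : ℝ => 1 - t) (volume.restrict (Set.Ioc (0 : ℝ) 1)) :=
    (Continuous.integrableOn_Ioc (by fun_prop))
  refine (h1.mul_prod h2).congr (Filter.Eventually.of_forall fun ω => ?_)
  simp only; ring

lemma FF_eq (e : ℝ × ℝ) (he : 0 < e.1) :
    FF e = -(e.2 ^ 2) * (M nuF tA tB tH 0 e + M nuF tA tB tH (-(Real.pi / 2)) e) := by
  have mA : Measurable tA := measurable_fst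
  have mB : Measurable tB := measurable_fst.mul measurable_snd
  have i1 := M_integrable mA mB tHc 0 e he
  have i2 := M_integrable mA mB tHc (-(Real.pi / 2)) e he
  have i3 : Integrable (fun ω => tH ω * Mk tA tB 0 e ω + tH ω * Mk tA tB (-(Real.pi / 2)) e ω) nuF := i1.add i2
  unfold M
  rw [← integral_add i1 i2]
  unfold nuF at i3 ⊢
  rw [integral_prod _ i3, ← integral_const_mul]
  unfold FF
  refine setIntegral_congr_fun measurableSet_Ioi fun r hr => ?_
  have hr' : 0 < r := hr
  simp only [tH, tA, tB, Mk, FI]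
  rw [← intervalIntegral.integral_of_le zero_le_one]
  have ec := taylor_cos (r * e.2)
  have es := taylor_sin (r * e.2)
  rw [intervalIntegral.integral_const_mul] at ec es
  have e1 : ∀ t : ℝ, (1 - t) * (Real.exp (-(e.1 * r ^ 2)) * Real.cos (e.2 * (r * t) + 0)) +
      (1 - t) * (Real.exp (-(e.1 * r ^ 2)) * Real.cos (e.2 * (r * t) + -(Real.pi / 2))) =
      Real.exp (-(e.1 * r ^ 2)) * ((1 - t) * Real.cos (t * (r * e.2)) + (1 - t) * Real.sin (t * (r * e.2))) := by
    intro t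
    rw [add_zero, ← sub_eq_add_neg, Real.cos_sub_pi_div_two, show e.2 * (r * t) = t * (r * e.2) by ring]
    ring
  simp only [e1]
  rw [intervalIntegral.integral_const_mul, intervalIntegral.integral_add
    (Continuous.intervalIntegrable (by fun_prop) _ _) (Continuous.intervalIntegrable (by fun_prop) _ _)]
  generalize (∫ t in (0 : ℝ)..1, (1 - t) * Real.cos (t * (r * e.2))) = I1 at *
  generalize (∫ t in (0 : ℝ)..1, (1 - t) * Real.sin (t * (r * e.2))) = I2 at *
  have e3 : Real.cos (r * e.2) - 1 + (Real.sin (r * e.2) - r * e.2) = -((r * e.2) ^ 2 * I1) - (r * e.2) ^ 2 * I2 := by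
    linarith
  rw [e3, neg_mul e.1]
  field_simp
  ring

lemma FF_contDiffOn : ContDiffOn ℝ 2 FF {e | 0 < e.1} := by
  have mA : Measurable tA := measurable_fst
  have mB : Measurable tB := measurable_fst.mul measurable_snd
  have hAB : ∀ᵐ ω ∂nuF, |tB ω| ≤ |tA ω| := by
    filter_upwards [nuF_ae] with ω hω
    unfold tA tB
    rw [abs_mul]
    exact mul_le_of_le_one_right (abs_nonneg _) (abs_le.2 ⟨by linarith [hω.1], hω.2⟩)
  have h1 := M_contDiffOn mA mB hAB 2 tH tHc 0
  have h2 := M_contDiffOn mA mB hAB 2 tH tHc (-(Real.pi / 2))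
  have h3 : ContDiffOn ℝ 2 (fun e : ℝ × ℝ => -(e.2 ^ 2)) {e | 0 < e.1} :=
    ((contDiff_snd.pow 2).neg).contDiffOn
  exact (h3.mul (h1.add h2)).congr fun e he => FF_eq e he

lemma FF_zero (s : ℝ) : FF (s, 0) = 0 := by
  unfold FF FI; simp

lemma FI_integrable (s y : ℝ) (hs : 0 < s) : IntegrableOn (FI s y) (Set.Ioi 0) := by
  have h1 := ((integrable_exp_neg_mul_sq hs).const_mul (2 * y ^ 2)).integrableOn (s := Set.Ioi (0 : ℝ))
  have hm : Measurable (FI s y) := by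
    unfold FI
    fun_prop
  refine Integrable.mono h1 hm.aestronglyMeasurable ?_
  refine (ae_restrict_mem measurableSet_Ioi).mono fun r hr => ?_
  have hr' : 0 < r := hr
  have b1 : ∀ z : ℝ, |Real.cos z - 1 + (Real.sin z - z)| ≤ 2 * z ^ 2 := by
    intro z
    have c1 := taylor_cos z
    have c2 := taylor_sin z
    have d : ∀ k : ℝ → ℝ, (∀ t, |k t| ≤ 1) → |∫ t in (0 : ℝ)..1, z ^ 2 * ((1 - t) * k t)| ≤ z ^ 2 := by
      intro k hk
      have := intervalIntegral.norm_integral_le_of_norm_le_const (a := 0) (b := 1) (C := z ^ 2)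
        (f := fun t => z ^ 2 * ((1 - t) * k t)) (fun t ht => by
          rw [Set.uIoc_of_le zero_le_one] at ht
          rw [norm_mul, norm_mul, Real.norm_of_nonneg (sq_nonneg z), Real.norm_eq_abs, Real.norm_eq_abs]
          have : |1 - t| ≤ 1 := abs_le.2 ⟨by linarith [ht.2], by linarith [ht.1]⟩
          have := hk t
          calc _ ≤ z ^ 2 * (1 * 1) := by gcongr
            _ = _ := by ring)
      simpa using this
    have d1 := d (fun t => Real.cos (t * z)) fun t => Real.abs_cos_le_one _
    have d2 := d (fun t => Real.sin (t * z)) fun t => Real.abs_sin_le_one _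
    rw [c1] at d1
    rw [c2] at d2
    rw [abs_le] at *
    constructor <;> linarith [d1.1, d1.2, d2.1, d2.2]
  unfold FI
  rw [norm_div, norm_mul, Real.norm_of_nonneg (Real.exp_pos _).le, Real.norm_of_nonneg (sq_nonneg r),
    Real.norm_of_nonneg (show (0 : ℝ) ≤ 2 * y ^ 2 * Real.exp (-s * r ^ 2) by positivity), div_le_iff₀ (by positivity), Real.norm_eq_abs]
  calc _ ≤ Real.exp (-s * r ^ 2) * (2 * (r * y) ^ 2) := by gcongr; exact b1 _
    _ = _ := by ring

def mu1 : Measure ℝ := volume.restrict (Set.Ioi 1)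
def iA (q : ℝ) : ℝ := q
def b1 (q : ℝ) : ℝ := psi (q + Real.pi / 2) - 1
def b2 (q : ℝ) : ℝ := psi q - 1
def cc (b : ℝ → ℝ) (q : ℝ) : ℝ := b q / q ^ 2

/-- admissible amplitude -/
structure Adm (b : ℝ → ℝ) : Prop where
  meas : Measurable b
  bd : ∀ q, |b q| ≤ 2
  van : ∀ q, 0 < q → q ≤ 1 → b q = 0

lemma adm1 : Adm b1 where
  meas := by
    have := psi_meas
    unfold b1
    exact (this.comp (measurable_id.add_const _)).sub_const _
  bd q := by
    have := abs_psi_le (q + Real.pi / 2)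
    unfold b1
    rw [abs_le] at *
    constructor <;> linarith [this.1, this.2]
  van q h0 h1 := by
    unfold b1
    rw [(psi_one q h0 h1).1]; ring

lemma adm2 : Adm b2 where
  meas := psi_meas.sub_const _
  bd q := by
    have := abs_psi_le q
    unfold b2
    rw [abs_le] at *
    constructor <;> linarith [this.1, this.2]
  van q h0 h1 := by
    unfold b2
    rw [(psi_one q h0 h1).2]; ring

lemma cc_meas {b : ℝ → ℝ} (hb : Adm b) : Measurable (cc b) := by
  have := hb.meas
  unfold cc
  fun_prop

lemma cc_hc {b : ℝ → ℝ} (hb : Adm b) : Hc mu1 iA (cc b) := by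
  intro a ha
  have h1 := ((integrable_exp_neg_mul_sq ha).const_mul 2).integrableOn (s := Set.Ioi (1 : ℝ))
  have hm := cc_meas hb
  have hm' : Measurable (fun ω => cc b ω * Real.exp (-(a * iA ω ^ 2))) := by unfold iA; fun_prop
  refine Integrable.mono h1 hm'.aestronglyMeasurable ?_
  refine (ae_restrict_mem measurableSet_Ioi).mono fun r hr => ?_
  have hr' : 1 < r := hr
  rw [norm_mul, norm_mul, Real.norm_of_nonneg (Real.exp_pos _).le, Real.norm_of_nonneg (Real.exp_pos _).le]
  unfold iA
  rw [neg_mul]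
  gcongr
  unfold cc
  rw [norm_div, Real.norm_eq_abs, Real.norm_of_nonneg (sq_nonneg r), div_le_iff₀ (by positivity)]
  have := hb.bd r
  simp only [Real.norm_ofNat]
  nlinarith

lemma adm_sq {b : ℝ → ℝ} (hb : Adm b) (p r : ℝ) (hp : 0 < p) (hr : 0 < r) : |b (r * p) / r ^ 2| ≤ 2 * p ^ 2 := by
  rw [abs_div, abs_of_nonneg (sq_nonneg r), div_le_iff₀ (by positivity)]
  by_cases h : r * p ≤ 1
  · rw [hb.van _ (by positivity) h]; simp; positivity
  · have := hb.bd (r * p)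
    push Not at h
    nlinarith [mul_pos hr hp]

lemma r_int {b : ℝ → ℝ} (hb : Adm b) (s p : ℝ) (hs : 0 < s) (hp : 0 < p) (C : ℝ → ℝ) (hC : Measurable C) (K : ℝ)
    (hK : ∀ r, |C r| ≤ K) :
    IntegrableOn (fun r => Real.exp (-s * r ^ 2) * (b (r * p) / r ^ 2 * C r)) (Set.Ioi 0) := by
  have h1 := ((integrable_exp_neg_mul_sq hs).const_mul (2 * p ^ 2 * K)).integrableOn (s := Set.Ioi (0 : ℝ))
  have hm : Measurable (fun r => b (r * p)) := hb.meas.comp (measurable_id.mul_const p)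
  have hm' : Measurable (fun r => Real.exp (-s * r ^ 2) * (b (r * p) / r ^ 2 * C r)) :=
    (by fun_prop : Measurable fun r : ℝ => Real.exp (-s * r ^ 2)).mul ((hm.div (by fun_prop)).mul hC)
  refine Integrable.mono h1 hm'.aestronglyMeasurable ?_
  refine (ae_restrict_mem measurableSet_Ioi).mono fun r hr => ?_
  have hr' : 0 < r := hr
  have hK0 : 0 ≤ K := (abs_nonneg _).trans (hK 0)
  rw [Real.norm_of_nonneg (show (0 : ℝ) ≤ 2 * p ^ 2 * K * Real.exp (-s * r ^ 2) by positivity),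
    norm_mul, norm_mul, Real.norm_of_nonneg (Real.exp_pos _).le, mul_comm]
  gcongr
  · exact adm_sq hb p r hp hr'
  · exact hK r

lemma W_rform {b : ℝ → ℝ} (hb : Adm b) (s p y φ : ℝ) (hs : 0 < s) (hp : 0 < p) :
    p * W mu1 iA iA (cc b) 0 φ (s, p, y) =
      ∫ r in Set.Ioi (0 : ℝ), Real.exp (-s * r ^ 2) * (b (r * p) / r ^ 2 * Real.cos (r * y + φ)) := by
  unfold W M mu1
  simp only [if_pos hp, pow_zero, one_mul]
  have e1 : ∫ q in Set.Ioi (1 : ℝ), cc b q * Mk iA iA φ (s * p⁻¹ ^ 2, y * p⁻¹) q =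
      ∫ q in Set.Ioi (0 : ℝ), cc b q * Mk iA iA φ (s * p⁻¹ ^ 2, y * p⁻¹) q := by
    symm
    refine setIntegral_eq_of_subset_of_forall_sdiff_eq_zero measurableSet_Ioi
      (Set.Ioi_subset_Ioi zero_le_one) fun q hq => ?_
    have h0 : 0 < q := hq.1
    have h1 : q ≤ 1 := not_lt.1 hq.2
    unfold cc
    rw [hb.van q h0 h1]; simp
  have e2 := integral_comp_mul_right_Ioi (fun q => cc b q * Mk iA iA φ (s * p⁻¹ ^ 2, y * p⁻¹) q) 0 hp
  rw [zero_mul, smul_eq_mul] at e2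
  have e3 : ∫ q in Set.Ioi (0 : ℝ), cc b q * Mk iA iA φ (s * p⁻¹ ^ 2, y * p⁻¹) q =
    p * ∫ (x : ℝ) in Set.Ioi 0, cc b (x * p) * Mk iA iA φ (s * p⁻¹ ^ 2, y * p⁻¹) (x * p) := by
    rw [e2]; field_simp
  rw [e1, e3, ← mul_assoc, ← integral_const_mul]
  refine setIntegral_congr_fun measurableSet_Ioi fun r hr => ?_
  have hr' : 0 < r := hr
  simp only [cc, Mk, iA]
  have a1 : s * p⁻¹ ^ 2 * (r * p) ^ 2 = s * r ^ 2 := by field_simp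
  have a2 : y * p⁻¹ * (r * p) = r * y := by field_simp
  rw [a1, a2, neg_mul]
  field_simp

def gg (w : ℝ × (ℝ × (Fin 4 → ℝ))) : ℝ :=
  2 * (w.1 * ∑ k, (W mu1 iA iA (cc b1) 0 0 (w.2.1, w.1, dot (alph k) w.2.2) +
    W mu1 iA iA (cc b2) 0 (-(Real.pi / 2)) (w.2.1, w.1, dot (alph k) w.2.2)))

def RR (s : ℝ) (C S : ℝ → ℝ) (p r : ℝ) : ℝ :=
  Real.exp (-s * r ^ 2) * (b1 (r * p) / r ^ 2 * C r) + Real.exp (-s * r ^ 2) * (b2 (r * p) / r ^ 2 * S r)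

lemma gg_nonpos (p s : ℝ) (x : Fin 4 → ℝ) (hp : p ≤ 0) : gg (p, s, x) = 0 := by
  unfold gg W
  simp [not_lt.2 hp]

def sC (x : Fin 4 → ℝ) (r : ℝ) : ℝ := ∑ k, Real.cos (r * dot (alph k) x)
def sS (x : Fin 4 → ℝ) (r : ℝ) : ℝ := ∑ k, Real.sin (r * dot (alph k) x)

lemma sC_cont (x) : Continuous (sC x) := by unfold sC; fun_prop
lemma sS_cont (x) : Continuous (sS x) := by unfold sS; fun_prop
lemma sC_bd (x r) : |sC x r| ≤ 4 := by
  unfold sC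
  refine (Finset.abs_sum_le_sum_abs _ _).trans ((Finset.sum_le_sum fun k _ => Real.abs_cos_le_one _).trans ?_)
  simp
lemma sS_bd (x r) : |sS x r| ≤ 4 := by
  unfold sS
  refine (Finset.abs_sum_le_sum_abs _ _).trans ((Finset.sum_le_sum fun k _ => Real.abs_sin_le_one _).trans ?_)
  simp

lemma RR_int (s p : ℝ) (x : Fin 4 → ℝ) (hs : 0 < s) (hp : 0 < p) :
    IntegrableOn (RR s (sC x) (sS x) p) (Set.Ioi 0) :=
  (r_int adm1 s p hs hp (sC x) (sC_cont x).measurable 4 (sC_bd x)).add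
    (r_int adm2 s p hs hp (sS x) (sS_cont x).measurable 4 (sS_bd x))

lemma gg_rform (p s : ℝ) (x : Fin 4 → ℝ) (hs : 0 < s) (hp : 0 < p) :
    gg (p, s, x) = 2 * ∫ r in Set.Ioi (0 : ℝ), RR s (sC x) (sS x) p r := by
  unfold gg
  simp only
  rw [Finset.mul_sum]
  simp only [mul_add]
  simp only [W_rform adm1 s p _ _ hs hp, W_rform adm2 s p _ _ hs hp]
  have i1 := fun k => r_int adm1 s p hs hp (fun r => Real.cos (r * dot (alph k) x + 0)) (by fun_prop) 1
    (fun r => Real.abs_cos_le_one _)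
  have i2 := fun k => r_int adm2 s p hs hp (fun r => Real.cos (r * dot (alph k) x + -(Real.pi / 2))) (by fun_prop) 1
    (fun r => Real.abs_cos_le_one _)
  rw [Finset.sum_add_distrib, ← integral_finsetSum _ fun k _ => i1 k, ← integral_finsetSum _ fun k _ => i2 k,
    ← integral_add (integrable_finsetSum _ fun k _ => i1 k) (integrable_finsetSum _ fun k _ => i2 k)]
  congr 1
  refine integral_congr_ae (Filter.Eventually.of_forall fun r => ?_)
  simp only [RR, sC, sS, Finset.mul_sum, add_zero, ← sub_eq_add_neg, Real.cos_sub_pi_div_two]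

lemma gg_contDiffOn : ContDiffOn ℝ 2 gg {w | w.2 ∈ {e : ℝ × (Fin 4 → ℝ) | 0 < e.1}} := by
  have hA : Measurable iA := measurable_id
  have hAB : ∀ᵐ ω ∂mu1, |iA ω| ≤ |iA ω| := Filter.Eventually.of_forall fun _ => le_rfl
  have hA1 : ∀ᵐ ω ∂mu1, 1 ≤ iA ω ^ 2 := by
    refine (ae_restrict_mem measurableSet_Ioi).mono fun r hr => ?_
    have hr' : 1 < r := hr
    unfold iA; nlinarith
  have key : ∀ b, Adm b → ∀ φ k, ContDiffOn ℝ 2 (fun w : ℝ × (ℝ × (Fin 4 → ℝ)) =>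
      W mu1 iA iA (cc b) 0 φ (w.2.1, w.1, dot (alph k) w.2.2)) {w | w.2 ∈ {e : ℝ × (Fin 4 → ℝ) | 0 < e.1}} := by
    intro b hb φ k
    have h := W_contDiffOn hA hA hAB hA1 2 (cc b) (cc_hc hb) 0 φ
    have hl : ContDiff ℝ 2 (fun w : ℝ × (ℝ × (Fin 4 → ℝ)) => ((w.2.1, w.1, dot (alph k) w.2.2) : ℝ × ℝ × ℝ)) := by
      unfold dot; fun_prop
    exact ContDiffOn.comp h hl.contDiffOn fun w hw => hw
  unfold gg
  refine contDiffOn_const.mul (contDiff_fst.contDiffOn.mul (ContDiffOn.sum fun k _ => ?_))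
  exact (key b1 adm1 _ _).add (key b2 adm2 _ _)

lemma sign_loc (a : ℝ) (ha : a ≠ 0) : ∀ᶠ b in nhds a, Real.sign b = Real.sign a := by
  rcases lt_or_gt_of_ne ha with h | h
  · filter_upwards [gt_mem_nhds h] with b hb
    rw [Real.sign_of_neg hb, Real.sign_of_neg h]
  · filter_upwards [lt_mem_nhds h] with b hb
    rw [Real.sign_of_pos hb, Real.sign_of_pos h]

lemma cos_lip (a b : ℝ) : |Real.cos a - Real.cos b| ≤ |a - b| := by
  simpa [Real.dist_eq] using Real.lipschitzWith_cos.dist_le_mul a b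
lemma sin_lip (a b : ℝ) : |Real.sin a - Real.sin b| ≤ |a - b| := by
  simpa [Real.dist_eq] using Real.lipschitzWith_sin.dist_le_mul a b

lemma ae_sin (p : ℝ) (hp : 0 < p) : ∀ᵐ r : ℝ, Real.sin (r * p) ≠ 0 ∧ Real.cos (r * p) ≠ 0 := by
  have hc : (Set.range fun n : ℤ => (n : ℝ) * Real.pi / (2 * p)).Countable := Set.countable_range _
  have h := hc.ae_notMem (volume : Measure ℝ)
  filter_upwards [h] with r hr
  by_contra hcon
  apply hr
  have h2 : Real.sin (2 * (r * p)) = 0 := by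
    rw [Real.sin_two_mul]
    by_cases h1 : Real.sin (r * p) = 0
    · rw [h1]; ring
    · have : Real.cos (r * p) = 0 := by
        by_contra h3; exact hcon ⟨h1, h3⟩
      rw [this]; ring
  obtain ⟨n, hn⟩ := Real.sin_eq_zero_iff.1 h2
  refine ⟨n, ?_⟩
  simp only
  rw [hn]; field_simp

lemma R_deriv (s p : ℝ) (x : Fin 4 → ℝ) (hs : 0 < s) (hp : 0 < p)
    (hC : ∀ r, |sC x r| ≤ 4 * |Real.cos (r * p)|) (hS : ∀ r, |sS x r| ≤ 4 * |Real.sin (r * p)|) :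
    HasDerivAt (fun q => ∫ r in Set.Ioi (0 : ℝ), RR s (sC x) (sS x) q r) 0 p := by
  have hn : Set.Ioo (p / 2) (2 * p) ∈ nhds p := Ioo_mem_nhds (by linarith) (by linarith)
  have key := (hasFDerivAt_integral_of_dominated_loc_of_lip' (𝕜 := ℝ) (F := fun q r => RR s (sC x) (sS x) q r)
    (F' := fun _ => (0 : ℝ →L[ℝ] ℝ)) (bound := fun r => 32 * p * Real.exp (-s * r ^ 2))
    (μ := volume.restrict (Set.Ioi 0)) hn ?_ ?_ ?_ ?_ ?_ ?_).2
  · rw [integral_zero] at key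
    have := key.hasDerivAt
    simpa using this
  · intro q hq
    exact (RR_int s q x hs (by linarith [hq.1])).aestronglyMeasurable
  · exact RR_int s p x hs hp
  · exact aestronglyMeasurable_const
  · refine (ae_restrict_mem measurableSet_Ioi).mono fun r hr q hq => ?_
    have hr' : 0 < r := hr
    have hq0 : 0 < q := by linarith [hq.1]
    rw [Real.norm_eq_abs, Real.norm_eq_abs]
    by_cases hsm : r * (2 * p) ≤ 1
    · have h1 : r * q ≤ 1 := by nlinarith [hq.2]
      have h2 : r * p ≤ 1 := by nlinarith
      unfold RR
      rw [adm1.van _ (by positivity) h1, adm2.van _ (by positivity) h1, adm1.van _ (by positivity) h2,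
        adm2.van _ (by positivity) h2]
      simp; positivity
    push Not at hsm
    have e1 : RR s (sC x) (sS x) q r - RR s (sC x) (sS x) p r = Real.exp (-s * r ^ 2) *
        (((b1 (r * q) - b1 (r * p)) * sC x r + (b2 (r * q) - b2 (r * p)) * sS x r) / r ^ 2) := by
      unfold RR; ring
    have hlip : |r * q - r * p| = r * |q - p| := by rw [← mul_sub, abs_mul, abs_of_pos hr']
    have d1 : |(b1 (r * q) - b1 (r * p)) * sC x r| ≤ 8 * (r * |q - p|) := by
      unfold b1
      rw [psi_shift, psi_shift, abs_mul, show ∀ a b : ℝ, a - 1 - (b - 1) = a - b by intros; ring]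
      have := sign_diff (Real.cos (r * q)) (Real.cos (r * p))
      have h2 := cos_lip (r * q) (r * p)
      rw [hlip] at h2
      have h3 := mul_le_mul_of_nonneg_left (hC r) (abs_nonneg (Real.sign (Real.cos (r * q)) - Real.sign (Real.cos (r * p))))
      linarith
    have d2 : |(b2 (r * q) - b2 (r * p)) * sS x r| ≤ 8 * (r * |q - p|) := by
      unfold b2 psi
      rw [abs_mul, show ∀ a b : ℝ, a - 1 - (b - 1) = a - b by intros; ring]
      have := sign_diff (Real.sin (r * q)) (Real.sin (r * p))
      have h2 := sin_lip (r * q) (r * p)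
      rw [hlip] at h2
      have h3 := mul_le_mul_of_nonneg_left (hS r) (abs_nonneg (Real.sign (Real.sin (r * q)) - Real.sign (Real.sin (r * p))))
      linarith
    rw [e1, abs_mul, abs_of_pos (Real.exp_pos _), abs_div, abs_of_nonneg (sq_nonneg r)]
    rw [show 32 * p * Real.exp (-s * r ^ 2) * |q - p| = Real.exp (-s * r ^ 2) * (32 * p * |q - p|) by ring]
    gcongr
    rw [div_le_iff₀ (by positivity)]
    refine (abs_add_le _ _).trans ((add_le_add d1 d2).trans ?_)
    have : 0 ≤ r * |q - p| := by positivity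
    nlinarith [mul_le_mul_of_nonneg_left hsm.le this]
  · exact ((integrable_exp_neg_mul_sq hs).const_mul _).integrableOn
  · refine ae_restrict_of_ae ((ae_sin p hp).mono fun r hr => ?_)
    have t1 : Filter.Tendsto (fun q => Real.sin (r * q)) (nhds p) (nhds (Real.sin (r * p))) :=
      (by fun_prop : Continuous fun q => Real.sin (r * q)).tendsto p
    have t2 : Filter.Tendsto (fun q => Real.cos (r * q)) (nhds p) (nhds (Real.cos (r * p))) :=
      (by fun_prop : Continuous fun q => Real.cos (r * q)).tendsto p
    have hev : (fun q => RR s (sC x) (sS x) q r) =ᶠ[nhds p] fun _ => RR s (sC x) (sS x) p r := by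
      filter_upwards [t1.eventually (sign_loc _ hr.1), t2.eventually (sign_loc _ hr.2)] with q h1 h2
      unfold RR b1 b2
      rw [psi_shift, psi_shift]
      unfold psi
      rw [h1, h2]
    exact (hasFDerivAt_const _ _).congr_of_eventuallyEq hev

lemma sC_perm (σ : Equiv.Perm (Fin 4)) (x : Fin 4 → ℝ) (r : ℝ) : sC (x ∘ σ) r = sC x r :=
  sum_alph_perm σ (fun y => Real.cos (r * y)) x
lemma sS_perm (σ : Equiv.Perm (Fin 4)) (x : Fin 4 → ℝ) (r : ℝ) : sS (x ∘ σ) r = sS x r :=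
  sum_alph_perm σ (fun y => Real.sin (r * y)) x

lemma sC_le (x : Fin 4 → ℝ) (r : ℝ) : |sC x r| ≤ 4 * |Real.cos (r * -dot theta x)| := by
  unfold sC
  rw [sum_cos, mul_neg, Real.cos_neg]
  have h1 := Real.abs_cos_le_one (r * dot th2 x)
  have h2 := Real.abs_cos_le_one (r * dot th3 x)
  simp only [abs_mul]
  rw [abs_of_pos (by norm_num : (0 : ℝ) < 4)]
  have h3 := mul_le_one₀ h1 (abs_nonneg _) h2
  have := abs_nonneg (Real.cos (r * dot theta x))
  nlinarith

lemma sS_le (x : Fin 4 → ℝ) (r : ℝ) : |sS x r| ≤ 4 * |Real.sin (r * -dot theta x)| := by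
  unfold sS
  rw [sum_sin, mul_neg, Real.sin_neg, abs_neg, abs_neg]
  have h1 := Real.abs_sin_le_one (r * dot th2 x)
  have h2 := Real.abs_sin_le_one (r * dot th3 x)
  simp only [abs_mul]
  rw [abs_of_pos (by norm_num : (0 : ℝ) < 4)]
  have h3 := mul_le_one₀ h1 (abs_nonneg _) h2
  have := abs_nonneg (Real.sin (r * dot theta x))
  nlinarith

lemma gg_fderiv (σ : Equiv.Perm (Fin 4)) (s : ℝ) (x : Fin 4 → ℝ) (hs : 0 < s) :
    fderiv ℝ gg (-dot theta (x ∘ σ), (s, x)) (1, 0) = 0 := by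
  set p := -dot theta (x ∘ σ) with hp
  have hopen : IsOpen {w : ℝ × (ℝ × (Fin 4 → ℝ)) | w.2 ∈ {e : ℝ × (Fin 4 → ℝ) | 0 < e.1}} :=
    isOpen_lt continuous_const (continuous_fst.comp continuous_snd)
  have hd : DifferentiableAt ℝ gg (p, (s, x)) :=
    (gg_contDiffOn.differentiableOn (by norm_num)).differentiableAt (hopen.mem_nhds hs)
  have h1 : HasDerivAt (fun q : ℝ => ((q, (s, x)) : ℝ × (ℝ × (Fin 4 → ℝ)))) (1, 0) p :=
    (hasDerivAt_id p).prodMk (hasDerivAt_const p (s, x))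
  have h2 : HasDerivAt (fun q : ℝ => gg (q, (s, x))) (fderiv ℝ gg (p, (s, x)) (1, 0)) p :=
    HasFDerivAt.comp_hasDerivAt (l := gg) (f := fun q : ℝ => ((q, (s, x)) : ℝ × (ℝ × (Fin 4 → ℝ)))) p hd.hasFDerivAt h1
  by_cases h0 : 0 < p
  · have h3 := (R_deriv s p x hs h0 (fun r => by rw [← sC_perm σ]; exact sC_le _ r)
      (fun r => by rw [← sS_perm σ]; exact sS_le _ r)).const_mul 2
    rw [mul_zero] at h3
    have h4 : HasDerivAt (fun q : ℝ => gg (q, (s, x))) 0 p :=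
      h3.congr_of_eventuallyEq ((lt_mem_nhds h0).mono fun q hq => gg_rform q s x hs hq)
    exact h2.unique h4
  · push Not at h0
    have h3 : HasDerivWithinAt (fun q : ℝ => gg (q, (s, x))) 0 (Set.Iic p) p :=
      (hasDerivWithinAt_const p _ (0 : ℝ)).congr (fun q hq => gg_nonpos q s x (le_trans hq h0)) (gg_nonpos p s x h0)
    exact (uniqueDiffWithinAt_Iic p).eq_deriv _ h2.hasDerivWithinAt h3

lemma psi_neg (a : ℝ) : psi (-a) = -psi a := by
  unfold psi; rw [Real.sin_neg, Real.sign_neg]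

lemma Lam_p (r : ℝ) (z : Fin 4 → ℝ) : Lam r z =
    psi (r * -dot theta z + Real.pi / 2) * sC z r - 4 + psi (r * -dot theta z) * sS z r := by
  unfold Lam sC sS
  rw [mul_neg, psi_neg, psi_shift, psi_shift, Real.cos_neg]; ring

lemma master (s : ℝ) (z : Fin 4 → ℝ) (hs : 0 < s) (hz : Monotone z) :
    ∫ r : ℝ, Real.exp (-s * r ^ 2) * Lam r z / r ^ 2 =
      2 * (∑ k, FF (s, dot (alph k) z)) + gg (-dot theta z, (s, z)) := by
  obtain ⟨h0, h1⟩ := theta_neg hz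
  rcases eq_or_lt_of_le h0 with h | h
  · have ha := h1 h
    rw [gg_nonpos _ _ _ (by rw [h]; simp)]
    simp only [ha, FF_zero]
    have hL : ∀ r, Lam r z = 0 := by
      intro r
      rw [Lam_p]
      unfold sC sS
      simp only [ha, h, mul_zero, neg_zero, Real.cos_zero, Real.sin_zero, zero_add]
      have : psi (Real.pi / 2) = 1 := by unfold psi; rw [Real.sin_pi_div_two, Real.sign_one]
      rw [this]; simp
    simp [hL]
  · have hp : 0 < -dot theta z := by linarith
    have e0 : ∀ r : ℝ, Real.exp (-s * r ^ 2) * Lam r z / r ^ 2 =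
        (fun r => Real.exp (-s * r ^ 2) * Lam r z / r ^ 2) |r| := by
      intro r; simp only [sq_abs, Lam_abs]
    rw [integral_congr_ae (Filter.Eventually.of_forall e0),
      integral_comp_abs (f := fun r => Real.exp (-s * r ^ 2) * Lam r z / r ^ 2), gg_rform _ _ _ hs hp, ← mul_add]
    congr 1
    unfold FF
    simp only
    rw [← integral_finsetSum _ fun k _ => FI_integrable s (dot (alph k) z) hs,
      ← integral_add (integrable_finsetSum _ fun k _ => FI_integrable s (dot (alph k) z) hs) (RR_int s _ z hs hp)]
    refine integral_congr_ae (Filter.Eventually.of_forall fun r => ?_)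
    simp only [FI]
    rw [← Finset.sum_div, ← Finset.mul_sum, Lam_p]
    have e1 : ∑ k, (Real.cos (r * dot (alph k) z) - 1 + (Real.sin (r * dot (alph k) z) - r * dot (alph k) z)) =
        sC z r - 4 + sS z r := by
      unfold sC sS
      rw [Finset.sum_add_distrib, Finset.sum_sub_distrib, Finset.sum_sub_distrib, ← Finset.mul_sum, sum_alph]
      simp
    rw [e1]
    unfold RR b1 b2
    ring

lemma gg_perm (σ : Equiv.Perm (Fin 4)) (p s : ℝ) (x : Fin 4 → ℝ) : gg (p, (s, x ∘ σ)) = gg (p, (s, x)) := by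
  unfold gg
  simp only
  rw [sum_alph_perm σ (fun y => W mu1 iA iA (cc b1) 0 0 (s, p, y) + W mu1 iA iA (cc b2) 0 (-(Real.pi / 2)) (s, p, y)) x]

def Lsg (σ : Equiv.Perm (Fin 4)) : (ℝ × (Fin 4 → ℝ)) →L[ℝ] ℝ :=
  -(∑ j, theta j • ((ContinuousLinearMap.proj (R := ℝ) (φ := fun _ : Fin 4 => ℝ) (σ j)).comp
    (ContinuousLinearMap.snd ℝ ℝ (Fin 4 → ℝ))))

lemma Lsg_apply (σ : Equiv.Perm (Fin 4)) (e : ℝ × (Fin 4 → ℝ)) : Lsg σ e = -dot theta (e.2 ∘ σ) := by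
  simp [Lsg, dot]

lemma gpart_contDiffOn : ContDiffOn ℝ 2 (fun e : ℝ × (Fin 4 → ℝ) => gg (-dot theta (sortv e.2), e)) {e | 0 < e.1} := by
  refine glue_main (ι := Equiv.Perm (Fin 4)) (C := fun σ => {e : ℝ × (Fin 4 → ℝ) | Monotone (e.2 ∘ σ)})
    (fun σ => (closed_mono σ).preimage continuous_snd) (fun e => ⟨Tuple.sort e.2, Tuple.monotone_sort e.2⟩)
    {e | 0 < e.1} (isOpen_lt continuous_const continuous_fst) Lsg gg gg_contDiffOn _ ?_ ?_ ?_
  · intro σ e he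
    simp only [emb, ContinuousLinearMap.prod_apply, ContinuousLinearMap.id_apply, Lsg_apply]
    rw [sortv_of_monotone e.2 σ he]
  · intro σ e he
    simp only [emb, ContinuousLinearMap.prod_apply, ContinuousLinearMap.id_apply, Lsg_apply]
    exact gg_fderiv σ e.1 e.2 he
  · intro σ τ e h1 h2
    rw [Lsg_apply, Lsg_apply, ← sortv_of_monotone e.2 σ h1, ← sortv_of_monotone e.2 τ h2]

lemma sortv_mono (x : Fin 4 → ℝ) : Monotone (sortv x) := Tuple.monotone_sort x

lemma G_contDiffOn : ContDiffOn ℝ 2 (fun e : ℝ × (Fin 4 → ℝ) => G e.1 e.2) {e | 0 < e.1} := by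
  have h1 : ∀ k, ContDiffOn ℝ 2 (fun e : ℝ × (Fin 4 → ℝ) => FF (e.1, dot (alph k) e.2)) {e | 0 < e.1} := by
    intro k
    have hl : ContDiff ℝ 2 (fun e : ℝ × (Fin 4 → ℝ) => ((e.1, dot (alph k) e.2) : ℝ × ℝ)) := by
      unfold dot; fun_prop
    exact ContDiffOn.comp (g := FF) (f := fun e : ℝ × (Fin 4 → ℝ) => ((e.1, dot (alph k) e.2) : ℝ × ℝ)) FF_contDiffOn hl.contDiffOn fun w hw => hw
  have h2 : ContDiffOn ℝ 2 (fun e : ℝ × (Fin 4 → ℝ) => 2 * (∑ k, FF (e.1, dot (alph k) e.2)) +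
      gg (-dot theta (sortv e.2), e)) {e | 0 < e.1} :=
    (contDiffOn_const.mul (ContDiffOn.sum fun k _ => h1 k)).add gpart_contDiffOn
  refine h2.congr fun e he => ?_
  have he' : 0 < e.1 := he
  unfold G
  rw [master e.1 _ he' (sortv_mono e.2)]
  have hs : sortv e.2 = e.2 ∘ (Tuple.sort e.2) := rfl
  congr 1
  · rw [hs, sum_alph_perm _ (fun y => FF (e.1, y))]
  · nth_rw 2 [hs]
    rw [gg_perm]

lemma u_eq (T : ℝ) (p : ℝ × (Fin 4 → ℝ)) : u T p.1 p.2 = -(1 / (16 * Real.sqrt 2)) * G (T - p.1) p.2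
    + (1 / 4) * ∑ i, p.2 i + (1 / 2) * Real.sqrt ((T - p.1) * Real.pi / 2) := rfl

/-- u^T is continuous on [0,T] × ℝ⁴ and C² on [0,T) × ℝ⁴. -/
theorem u_regularity (T : ℝ) (hT : 0 < T) :
    ContinuousOn (fun p : ℝ × (Fin 4 → ℝ) => u T p.1 p.2)
      (Set.Icc (0 : ℝ) T ×ˢ (Set.univ : Set (Fin 4 → ℝ))) ∧
    ContDiffOn ℝ 2 (fun p : ℝ × (Fin 4 → ℝ) => u T p.1 p.2)
      (Set.Ico (0 : ℝ) T ×ˢ (Set.univ : Set (Fin 4 → ℝ))) := by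
  simp only [u_eq]
  constructor
  · have hl : Continuous (fun p : ℝ × (Fin 4 → ℝ) => ((T - p.1, p.2) : ℝ × (Fin 4 → ℝ))) := by fun_prop
    have h1 : ContinuousOn (fun p : ℝ × (Fin 4 → ℝ) => G (T - p.1) p.2)
        (Set.Icc (0 : ℝ) T ×ˢ (Set.univ : Set (Fin 4 → ℝ))) :=
      ContinuousOn.comp (g := fun e : ℝ × (Fin 4 → ℝ) => G e.1 e.2)
        (f := fun p : ℝ × (Fin 4 → ℝ) => ((T - p.1, p.2) : ℝ × (Fin 4 → ℝ))) G_continuousOn hl.continuousOn fun p hp => sub_nonneg.2 hp.1.2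
    have h2 : Continuous (fun p : ℝ × (Fin 4 → ℝ) => (1 / 4) * ∑ i, p.2 i) := by fun_prop
    have h3 : Continuous (fun p : ℝ × (Fin 4 → ℝ) => (1 / 2) * Real.sqrt ((T - p.1) * Real.pi / 2)) := by fun_prop
    exact ((continuousOn_const.mul h1).add h2.continuousOn).add h3.continuousOn
  · have hl : ContDiff ℝ 2 (fun p : ℝ × (Fin 4 → ℝ) => ((T - p.1, p.2) : ℝ × (Fin 4 → ℝ))) := by fun_prop
    have h1 : ContDiffOn ℝ 2 (fun p : ℝ × (Fin 4 → ℝ) => G (T - p.1) p.2)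
        (Set.Ico (0 : ℝ) T ×ˢ (Set.univ : Set (Fin 4 → ℝ))) :=
      ContDiffOn.comp (g := fun e : ℝ × (Fin 4 → ℝ) => G e.1 e.2)
        (f := fun p : ℝ × (Fin 4 → ℝ) => ((T - p.1, p.2) : ℝ × (Fin 4 → ℝ))) G_contDiffOn hl.contDiffOn fun p hp => sub_pos.2 hp.1.2
    have h2 : ContDiff ℝ 2 (fun p : ℝ × (Fin 4 → ℝ) => (1 / 4) * ∑ i, p.2 i) := by fun_prop
    have h4 : ContDiff ℝ 2 (fun p : ℝ × (Fin 4 → ℝ) => (T - p.1) * Real.pi / 2) := by fun_prop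
    have h3 : ContDiffOn ℝ 2 (fun p : ℝ × (Fin 4 → ℝ) => (1 / 2) * Real.sqrt ((T - p.1) * Real.pi / 2))
        (Set.Ico (0 : ℝ) T ×ˢ (Set.univ : Set (Fin 4 → ℝ))) :=
      contDiffOn_const.mul (h4.contDiffOn.sqrt fun p hp => by
        have : 0 < T - p.1 := sub_pos.2 hp.1.2
        have := Real.pi_pos
        positivity)
    exact ((contDiffOn_const.mul h1).add h2.contDiffOn).add h3

end
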